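/- arXiv:2310.05040 — 3 statements merged into one kernel-verified Lean document; each statement's English description precedes it below -/
import Mathlib

section
/- Let (ρ, u) be a radially symmetric strong solution on [0,R] × [0,T] with ‖ρ‖_{L^∞(Ω×(0,T))} ≤ C₀, and let F = (2μ + ρ^β)(u_r + u/r) − ρ^γ and λ = ρ^β. Then there is a constant C depending only on C₀, μ, β, γ, Ω and the initial data such that at each time t ∈ [0,T], ‖∇u‖_{L⁴(Ω)}⁴ ≤ C + C (‖∇u‖_{L²(Ω)}² + 1) ( ‖√ρ u̇‖_{L²(Ω)}² + ∫_Ω F²/(2μ+λ) dx ), where u̇ = u_t + u u_r. -/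
open MeasureTheory Set Filter

noncomputable section

/-- Radial divergence `u_r + u/r` of the 2D radial vector field `x ↦ u(|x|,t) x/|x|`. -/
def rdiv (u : ℝ → ℝ → ℝ) (r t : ℝ) : ℝ := deriv (fun s => u s t) r + u r t / r

/-- Squared gradient `u_r² + u²/r²` of the 2D radial vector field. -/
def gradSq (u : ℝ → ℝ → ℝ) (r t : ℝ) : ℝ :=
  (deriv (fun s => u s t) r) ^ 2 + (u r t / r) ^ 2

/-- Material derivative `u̇ = u_t + u u_r` of the radial velocity. -/
def mder (u : ℝ → ℝ → ℝ) (r t : ℝ) : ℝ :=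
  deriv (fun τ => u r τ) t + u r t * deriv (fun s => u s t) r

/-- Effective viscous flux `F = (2μ + ρ^β)(u_r + u/r) - ρ^γ`. -/
def flux (μ β γ : ℝ) (ρ u : ℝ → ℝ → ℝ) (r t : ℝ) : ℝ :=
  (2 * μ + ρ r t ^ β) * rdiv u r t - ρ r t ^ γ

/-- A radially symmetric (smooth, strong) solution on `[0,R] × [0,T]` of the isentropic
compressible Navier–Stokes system with `μ > 0`, `λ(ρ) = ρ^β`, `P(ρ) = ρ^γ`, written in
radial coordinates: `ρ_t + (ρu)_r + ρu/r = 0` and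
`(ρu)_t + (ρu²)_r + ρu²/r + (ρ^γ)_r = [(2μ + ρ^β)(u_r + u/r)]_r`, with Dirichlet
boundary conditions `u(0,t) = u(R,t) = 0`. -/
structure RadialSolution (μ β γ R T : ℝ) (ρ u : ℝ → ℝ → ℝ) : Prop where
  hμ : 0 < μ
  hβ : 1 < β
  hγ : 1 < γ
  hR : 0 < R
  hT : 0 < T
  smooth_ρ : ∀ n : ℕ, ContDiff ℝ n (Function.uncurry ρ)
  smooth_u : ∀ n : ℕ, ContDiff ℝ n (Function.uncurry u)
  ρ_pos : ∀ r ∈ Icc 0 R, ∀ t ∈ Icc 0 T, 0 < ρ r t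
  mass : ∀ r ∈ Ioo 0 R, ∀ t ∈ Icc 0 T,
    deriv (fun τ => ρ r τ) t + deriv (fun s => ρ s t * u s t) r + ρ r t * u r t / r = 0
  momentum : ∀ r ∈ Ioo 0 R, ∀ t ∈ Icc 0 T,
    deriv (fun τ => ρ r τ * u r τ) t + deriv (fun s => ρ s t * u s t ^ 2) r
      + ρ r t * u r t ^ 2 / r + deriv (fun s => ρ s t ^ γ) r
      = deriv (fun s => (2 * μ + ρ s t ^ β) * rdiv u s t) r
  bc0 : ∀ t ∈ Icc 0 T, u 0 t = 0
  bcR : ∀ t ∈ Icc 0 T, u R t = 0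

/-- Integral inequality for continuous functions, from a pointwise inequality on `(0,R)`. -/
theorem ii_mono {R : ℝ} (hR : 0 < R) {f g : ℝ → ℝ}
    (hf : IntervalIntegrable f volume 0 R) (hg : IntervalIntegrable g volume 0 R)
    (h : ∀ r ∈ Ioo 0 R, f r ≤ g r) : (∫ r in (0:ℝ)..R, f r) ≤ ∫ r in (0:ℝ)..R, g r :=
  intervalIntegral.integral_mono_on_of_le_Ioo hR.le hf hg h

/-- Weighted Cauchy-Schwarz. -/
theorem weighted_cs {R : ℝ} (hR : 0 < R) {G G' : ℝ → ℝ} (hG : Continuous G)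
    (hG' : Continuous G') :
    (∫ r in (0:ℝ)..R, |G r| * |G' r| * r) ^ 2
      ≤ (∫ r in (0:ℝ)..R, G r ^ 2 * r) * (∫ r in (0:ℝ)..R, G' r ^ 2 * r) := by
  have key : ∀ x : ℝ, 0 ≤ (∫ r in (0:ℝ)..R, G r ^ 2 * r) * (x * x)
      + (2 * ∫ r in (0:ℝ)..R, |G r| * |G' r| * r) * x + (∫ r in (0:ℝ)..R, G' r ^ 2 * r) := by
    intro x
    have h0 : 0 ≤ ∫ r in (0:ℝ)..R, (|G r| * x + |G' r|) ^ 2 * r := by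
      apply intervalIntegral.integral_nonneg hR.le
      intro r hr
      have := hr.1
      positivity
    have h1 : (∫ r in (0:ℝ)..R, (|G r| * x + |G' r|) ^ 2 * r)
        = ∫ r in (0:ℝ)..R, ((x * x) * (G r ^ 2 * r) + (2 * x) * (|G r| * |G' r| * r)
          + G' r ^ 2 * r) := by
      congr 1
      ext r
      have e1 := sq_abs (G r)
      have e2 := sq_abs (G' r)
      rw [← e1, ← e2]
      ring
    rw [h1, intervalIntegral.integral_add, intervalIntegral.integral_add,
      intervalIntegral.integral_const_mul, intervalIntegral.integral_const_mul] at h0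
    · linarith
    all_goals (apply Continuous.intervalIntegrable; fun_prop)
  have := discrim_le_zero key
  unfold discrim at this
  nlinarith

/-- Radial Ladyzhenskaya inequality on a disc. -/
theorem radial_lady {R : ℝ} (hR : 0 < R) {G G' : ℝ → ℝ} (hG : Continuous G)
    (hG' : Continuous G') (hd : ∀ r ∈ Ioo 0 R, HasDerivAt G (G' r) r) :
    (∫ r in (0:ℝ)..R, G r ^ 4 * r) ≤ (8 / R ^ 2 + 22) * (∫ r in (0:ℝ)..R, G r ^ 2 * r)
      * ((∫ r in (0:ℝ)..R, G r ^ 2 * r) + ∫ r in (0:ℝ)..R, G' r ^ 2 * r) := by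
  have cs := weighted_cs hR hG hG'
  set a := ∫ r in (0:ℝ)..R, G r ^ 2 * r with ha
  set b := ∫ r in (0:ℝ)..R, G' r ^ 2 * r with hb
  set p := ∫ r in (0:ℝ)..R, |G r| * |G' r| * r with hp
  have ha0 : 0 ≤ a := intervalIntegral.integral_nonneg hR.le fun r hr => by
    have := hr.1
    positivity
  have hb0 : 0 ≤ b := intervalIntegral.integral_nonneg hR.le fun r hr => by
    have := hr.1
    positivity
  have hp0 : 0 ≤ p := intervalIntegral.integral_nonneg hR.le fun r hr => by
    have := hr.1
    positivity
  -- boundary value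
  have hbd : R ^ 2 * G R ^ 2 ≤ 2 * a + 2 * R * p := by
    have e := intervalIntegral.integral_eq_sub_of_hasDerivAt_of_le (a := 0) (b := R)
      (f := fun r => r ^ 2 * G r ^ 2) (f' := fun r => 2 * r * G r ^ 2 + r ^ 2 * (2 * G r * G' r))
      hR.le (by fun_prop) (fun r hr => by
        have := (hasDerivAt_pow 2 r).mul ((hd r hr).pow 2)
        refine this.congr_deriv ?_
        simp) (by apply Continuous.intervalIntegrable; fun_prop)
    have m : (∫ r in (0:ℝ)..R, (2 * r * G r ^ 2 + r ^ 2 * (2 * G r * G' r)))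
        ≤ ∫ r in (0:ℝ)..R, (2 * (G r ^ 2 * r) + (2 * R) * (|G r| * |G' r| * r)) := by
      apply ii_mono hR
      · apply Continuous.intervalIntegrable; fun_prop
      · apply Continuous.intervalIntegrable; fun_prop
      intro r hr
      have h1 : G r * G' r ≤ |G r| * |G' r| := by rw [← abs_mul]; exact le_abs_self _
      have h2 : r ^ 2 * (G r * G' r) ≤ r ^ 2 * (|G r| * |G' r|) :=
        mul_le_mul_of_nonneg_left h1 (sq_nonneg r)
      have h3 : r * (r * (|G r| * |G' r|)) ≤ R * (r * (|G r| * |G' r|)) :=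
        mul_le_mul_of_nonneg_right hr.2.le
          (mul_nonneg hr.1.le (mul_nonneg (abs_nonneg _) (abs_nonneg _)))
      nlinarith
    rw [e, intervalIntegral.integral_add, intervalIntegral.integral_const_mul,
      intervalIntegral.integral_const_mul] at m
    · simp only [← ha, ← hp] at m
      simpa using m
    all_goals (apply Continuous.intervalIntegrable; fun_prop)
  have hbd2 : R * G R ^ 2 ≤ 2 * (a / R) + 2 * p := by
    have : R * (R * G R ^ 2) ≤ R * (2 * (a / R) + 2 * p) := by
      have : R * (2 * (a / R) + 2 * p) = 2 * a + 2 * R * p := by field_simp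
      rw [this]; linarith
    exact le_of_mul_le_mul_left this hR
  set M := 2 * (a / R) + 4 * p with hM
  have hsup : ∀ r ∈ Ioo 0 R, r * G r ^ 2 ≤ M := by
    intro x hx
    have e := intervalIntegral.integral_eq_sub_of_hasDerivAt_of_le (a := x) (b := R)
      (f := fun r => r * G r ^ 2) (f' := fun r => 1 * G r ^ 2 + r * (2 * G r * G' r))
      hx.2.le (by fun_prop) (fun r hr => by
        have := (hasDerivAt_id r).mul ((hd r ⟨hx.1.trans hr.1, hr.2⟩).pow 2)
        refine this.congr_deriv ?_
        simp) (by apply Continuous.intervalIntegrable; fun_prop)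
    have m : (∫ r in x..R, (-2) * (|G r| * |G' r| * r))
        ≤ ∫ r in x..R, (1 * G r ^ 2 + r * (2 * G r * G' r)) := by
      apply intervalIntegral.integral_mono_on_of_le_Ioo hx.2.le
      · apply Continuous.intervalIntegrable; fun_prop
      · apply Continuous.intervalIntegrable; fun_prop
      intro r hr
      have h1 : -(|G r| * |G' r|) ≤ G r * G' r := by rw [← abs_mul]; exact neg_abs_le _
      have h2 := mul_le_mul_of_nonneg_left h1 (hx.1.trans hr.1).le
      nlinarith [sq_nonneg (G r)]
    have q : (∫ r in x..R, |G r| * |G' r| * r) ≤ p := by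
      have s := intervalIntegral.integral_add_adjacent_intervals (a := 0) (b := x) (c := R)
        (f := fun r => |G r| * |G' r| * r) (μ := volume)
        (by apply Continuous.intervalIntegrable; fun_prop)
        (by apply Continuous.intervalIntegrable; fun_prop)
      have : 0 ≤ ∫ r in (0:ℝ)..x, |G r| * |G' r| * r :=
        intervalIntegral.integral_nonneg hx.1.le fun r hr => by
          have := hr.1
          positivity
      linarith
    rw [intervalIntegral.integral_const_mul, e] at m
    linarith
  have hM0 : 0 ≤ M := by positivity
  have main : (∫ r in (0:ℝ)..R, G r ^ 4 * r) ≤ M ^ 2 / 2 + 2 * M * p := by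
    have e := intervalIntegral.integral_eq_sub_of_hasDerivAt_of_le (a := 0) (b := R)
      (f := fun r => r ^ 2 * G r ^ 4) (f' := fun r => 2 * r * G r ^ 4 + r ^ 2 * (4 * G r ^ 3 * G' r))
      hR.le (by fun_prop) (fun r hr => by
        have := (hasDerivAt_pow 2 r).mul ((hd r hr).pow 4)
        refine this.congr_deriv ?_
        simp) (by apply Continuous.intervalIntegrable; fun_prop)
    have m : (∫ r in (0:ℝ)..R, (2 * (G r ^ 4 * r) + (- 4 * M) * (|G r| * |G' r| * r)))
        ≤ ∫ r in (0:ℝ)..R, (2 * r * G r ^ 4 + r ^ 2 * (4 * G r ^ 3 * G' r)) := by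
      apply ii_mono hR
      · apply Continuous.intervalIntegrable; fun_prop
      · apply Continuous.intervalIntegrable; fun_prop
      intro r hr
      have h1 : -(|G r| * |G' r|) ≤ G r * G' r := by rw [← abs_mul]; exact neg_abs_le _
      have h0 : 0 ≤ r ^ 2 * G r ^ 2 := by positivity
      have h2 := mul_le_mul_of_nonneg_left h1 h0
      have h3 : (r * G r ^ 2) * (r * (|G r| * |G' r|)) ≤ M * (r * (|G r| * |G' r|)) :=
        mul_le_mul_of_nonneg_right (hsup r hr)
          (mul_nonneg hr.1.le (mul_nonneg (abs_nonneg _) (abs_nonneg _)))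
      nlinarith
    rw [intervalIntegral.integral_add, intervalIntegral.integral_const_mul,
      intervalIntegral.integral_const_mul, e] at m
    · simp only [← hp] at m
      have h5 : R ^ 2 * G R ^ 4 ≤ M ^ 2 := by
        have : R * G R ^ 2 ≤ M := by linarith
        calc R ^ 2 * G R ^ 4 = (R * G R ^ 2) ^ 2 := by ring
          _ ≤ M ^ 2 := by gcongr
      norm_num at m
      linarith
    all_goals (apply Continuous.intervalIntegrable; fun_prop)
  refine main.trans ?_
  have : (8 / R ^ 2 + 22) * a * (a + b) = 8 * (a / R) ^ 2 + 22 * (a * a)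
      + 8 / R ^ 2 * (a * b) + 22 * (a * b) := by field_simp; ring
  rw [this, hM]
  have h6 : 0 ≤ 8 / R ^ 2 * (a * b) := by positivity
  nlinarith [sq_nonneg (a / R - p), mul_nonneg ha0 ha0]

/-- Radial elliptic (Hardy type) estimate. -/
theorem radial_elliptic {R : ℝ} (hR : 0 < R) {v v' w : ℝ → ℝ} (hv : Continuous v')
    (hw : Continuous w) (hd : ∀ r, HasDerivAt v (v' r) r)
    (hvw : ∀ r, v r = r * w r) :
    (∫ r in (0:ℝ)..R, (v' r ^ 2 + w r ^ 2) ^ 2 * r) ≤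
      22 * ∫ r in (0:ℝ)..R, (v' r + w r) ^ 4 * r := by
  have e := intervalIntegral.integral_eq_sub_of_hasDerivAt_of_le (a := 0) (b := R)
      (f := fun r => r ^ 2 * w r ^ 4)
      (f' := fun r => 4 * w r ^ 3 * (v' r + w r) * r - 6 * (w r ^ 4 * r))
      hR.le (by fun_prop) (fun r hr => by
        have hr0 : r ≠ 0 := hr.1.ne'
        have h := ((hd r).pow 4).div (hasDerivAt_pow 2 r) (pow_ne_zero 2 hr0)
        have h' := h.congr_of_eventuallyEq (f₁ := fun r => r ^ 2 * w r ^ 4) (by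
          filter_upwards [eventually_ne_nhds hr0] with s hs
          simp only [Pi.div_apply, Pi.pow_apply, hvw]
          field_simp)
        refine h'.congr_deriv ?_
        simp only [hvw, Pi.pow_apply]
        field_simp
        push_cast
        ring) (by apply Continuous.intervalIntegrable; fun_prop)
  have m : (∫ r in (0:ℝ)..R, (4 * w r ^ 3 * (v' r + w r) * r - 6 * (w r ^ 4 * r)))
      ≤ ∫ r in (0:ℝ)..R, ((v' r + w r) ^ 4 * r + (-3) * (w r ^ 4 * r)) := by
    apply ii_mono hR
    · apply Continuous.intervalIntegrable; fun_prop
    · apply Continuous.intervalIntegrable; fun_prop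
    intro r hr
    have y : 4 * w r ^ 3 * (v' r + w r) ≤ 3 * w r ^ 4 + (v' r + w r) ^ 4 := by
      generalize v' r + w r = d
      nlinarith [sq_nonneg (w r ^ 2 - d ^ 2), mul_nonneg (sq_nonneg (w r)) (sq_nonneg (w r - d)), sq_nonneg (w r * (w r - d))]
    nlinarith [mul_le_mul_of_nonneg_right y hr.1.le]
  rw [intervalIntegral.integral_add, intervalIntegral.integral_const_mul, e] at m
  · have m2 : (∫ r in (0:ℝ)..R, (v' r ^ 2 + w r ^ 2) ^ 2 * r) ≤
        ∫ r in (0:ℝ)..R, (16 * ((v' r + w r) ^ 4 * r) + 18 * (w r ^ 4 * r)) := by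
      apply ii_mono hR
      · apply Continuous.intervalIntegrable; fun_prop
      · apply Continuous.intervalIntegrable; fun_prop
      intro r hr
      have y : (v' r ^ 2 + w r ^ 2) ^ 2 ≤ 16 * (v' r + w r) ^ 4 + 18 * w r ^ 4 := by
        have y1 : v' r ^ 2 ≤ 2 * (v' r + w r) ^ 2 + 2 * w r ^ 2 := by
          nlinarith [sq_nonneg (v' r + 2 * w r)]
        have y2 : (v' r ^ 2) ^ 2 ≤ (2 * (v' r + w r) ^ 2 + 2 * w r ^ 2) ^ 2 := by gcongr
        nlinarith [sq_nonneg ((v' r + w r) ^ 2 - w r ^ 2), sq_nonneg (v' r ^ 2 - w r ^ 2)]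
      nlinarith [mul_le_mul_of_nonneg_right y hr.1.le]
    rw [intervalIntegral.integral_add, intervalIntegral.integral_const_mul,
      intervalIntegral.integral_const_mul] at m2
    · have : 0 ≤ R ^ 2 * w R ^ 4 := by positivity
      norm_num at m
      linarith
    all_goals (apply Continuous.intervalIntegrable; fun_prop)
  all_goals (apply Continuous.intervalIntegrable; fun_prop)

theorem add_pow_le_pow_four (x y : ℝ) : (x + y) ^ 4 ≤ 8 * x ^ 4 + 8 * y ^ 4 := by
  have h1 : (x + y) ^ 2 ≤ 2 * x ^ 2 + 2 * y ^ 2 := by nlinarith [sq_nonneg (x - y)]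
  have h2 : ((x + y) ^ 2) ^ 2 ≤ (2 * x ^ 2 + 2 * y ^ 2) ^ 2 := by gcongr
  nlinarith [sq_nonneg (x ^ 2 - y ^ 2)]

/-- The one-dimensional profiles at a fixed time, extended continuously through `r = 0`. -/
theorem radial_data {μ β γ R T : ℝ} {ρ u : ℝ → ℝ → ℝ} (sol : RadialSolution μ β γ R T ρ u)
    {t : ℝ} (ht : t ∈ Icc 0 T) :
    ∃ w G G' v' q m : ℝ → ℝ, Continuous v' ∧ Continuous w ∧ Continuous G ∧ Continuous G' ∧
      Continuous q ∧ Continuous m ∧ (∀ r, HasDerivAt (fun s => u s t) (v' r) r) ∧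
      (∀ r, u r t = r * w r) ∧ (∀ r ∈ Ioo 0 R, HasDerivAt G (G' r) r) ∧
      (∀ r, deriv (fun s => u s t) r = v' r) ∧ (∀ r ∈ Ioo 0 R, u r t / r = w r) ∧
      (∀ r, ρ r t = q r) ∧ (∀ r, mder u r t = m r) ∧
      (∀ r, G r = (2 * μ + q r ^ β) * (v' r + w r) - q r ^ γ) ∧
      (∀ r, G' r = q r * m r) := by
  have hu2 : ContDiff ℝ 2 (Function.uncurry u) := by exact_mod_cast sol.smooth_u 2
  have hρ2 : ContDiff ℝ 2 (Function.uncurry ρ) := by exact_mod_cast sol.smooth_ρ 2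
  have hv : ContDiff ℝ 2 (fun s => u s t) :=
    hu2.comp (contDiff_id.prodMk contDiff_const : ContDiff ℝ 2 fun s : ℝ => (s, t))
  have hq : ContDiff ℝ 2 (fun s => ρ s t) :=
    hρ2.comp (contDiff_id.prodMk contDiff_const : ContDiff ℝ 2 fun s : ℝ => (s, t))
  have hvt : ∀ r, ContDiff ℝ 2 (fun τ => u r τ) := fun r =>
    hu2.comp (contDiff_const.prodMk contDiff_id : ContDiff ℝ 2 fun τ : ℝ => (r, τ))
  have hqt : ∀ r, ContDiff ℝ 2 (fun τ => ρ r τ) := fun r =>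
    hρ2.comp (contDiff_const.prodMk contDiff_id : ContDiff ℝ 2 fun τ : ℝ => (r, τ))
  have hv'1 : ContDiff ℝ 1 (deriv (fun s => u s t)) := by
    have : ContDiff ℝ (1 + 1) (fun s => u s t) := by simpa [one_add_one_eq_two] using hv
    exact (contDiff_succ_iff_deriv.1 this).2.2
  have hut : Continuous fun r => deriv (fun τ => u r τ) t := by
    have e : (fun r => deriv (fun τ => u r τ) t)
        = fun r => fderiv ℝ (Function.uncurry u) (r, t) (0, 1) := by
      funext r
      have h1 : HasFDerivAt (Function.uncurry u) (fderiv ℝ (Function.uncurry u) (r, t)) (r, t) :=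
        (hu2.differentiable (by norm_num) (r, t)).hasFDerivAt
      have h2 : HasDerivAt (fun τ : ℝ => (r, τ)) ((0 : ℝ), (1 : ℝ)) t :=
        (hasDerivAt_const t r).prodMk (hasDerivAt_id t)
      exact (h1.comp_hasDerivAt t h2).deriv
    rw [e]
    have hc := hu2.continuous_fderiv (by norm_num)
    exact (hc.comp (by fun_prop : Continuous fun r : ℝ => (r, t))).clm_apply continuous_const
  have hdv : ∀ r, DifferentiableAt ℝ (fun s => u s t) r := fun r =>
    hv.differentiable (by norm_num) r
  have hdq : ∀ r, DifferentiableAt ℝ (fun s => ρ s t) r := fun r =>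
    hq.differentiable (by norm_num) r
  have hu0 := sol.bc0 t ht
  have hβ := sol.hβ
  have hγ := sol.hγ
  have hw : Continuous (dslope (fun s => u s t) 0) := by
    rw [continuous_iff_continuousAt]
    intro r
    by_cases h : r = 0
    · subst h
      exact continuousAt_dslope_same.2 (hdv 0)
    · exact (continuousAt_dslope_of_ne h).2 (hdv r).continuousAt
  have hwe : ∀ r, r ≠ 0 → dslope (fun s => u s t) 0 r = u r t / r := by
    intro r hr
    rw [dslope_of_ne _ hr, slope_def_field, hu0]
    simp
  have hqβ : Continuous fun r => ρ r t ^ β := hq.continuous.rpow_const fun _ => Or.inr (by linarith)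
  have hqγ : Continuous fun r => ρ r t ^ γ := hq.continuous.rpow_const fun _ => Or.inr (by linarith)
  have hv'c := hv'1.continuous
  have hqc := hq.continuous
  have hvc := hv.continuous
  have hmc : Continuous fun r => mder u r t := by
    unfold mder
    fun_prop
  refine ⟨dslope (fun s => u s t) 0,
    fun r => (2 * μ + ρ r t ^ β) * (deriv (fun s => u s t) r + dslope (fun s => u s t) 0 r)
      - ρ r t ^ γ,
    fun r => ρ r t * mder u r t, deriv (fun s => u s t), fun r => ρ r t, fun r => mder u r t,
    hv'c, hw, by fun_prop, by fun_prop, hqc, hmc, fun r => (hdv r).hasDerivAt, ?_, ?_,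
    fun _ => rfl, fun r hr => (hwe r hr.1.ne').symm, fun _ => rfl, fun _ => rfl, fun _ => rfl,
    fun _ => rfl⟩
  · intro r
    by_cases h : r = 0
    · subst h
      simp [hu0]
    · rw [hwe r h]
      field_simp
  · intro r hr
    have hr0 : r ≠ 0 := hr.1.ne'
    have hρp : 0 < ρ r t := sol.ρ_pos r (Ioo_subset_Icc_self hr) t ht
    have dβ : DifferentiableAt ℝ (fun s => ρ s t ^ β) r := (hdq r).rpow_const (Or.inl hρp.ne')
    have dγ : DifferentiableAt ℝ (fun s => ρ s t ^ γ) r := (hdq r).rpow_const (Or.inl hρp.ne')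
    have dv' : DifferentiableAt ℝ (deriv (fun s => u s t)) r :=
      hv'1.differentiable (by norm_num) r
    have dD : DifferentiableAt ℝ (fun s => rdiv u s t) r := by
      unfold rdiv
      exact dv'.add ((hdv r).div differentiableAt_id hr0)
    have dS : DifferentiableAt ℝ (fun s => (2 * μ + ρ s t ^ β) * rdiv u s t) r :=
      (dβ.const_add _).mul dD
    have hs := dS.hasDerivAt.sub dγ.hasDerivAt
    have hs' := hs.congr_of_eventuallyEq (f₁ := fun r => (2 * μ + ρ r t ^ β) *
      (deriv (fun s => u s t) r + dslope (fun s => u s t) 0 r) - ρ r t ^ γ) (by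
        filter_upwards [eventually_ne_nhds hr0] with s hs
        simp only [Pi.sub_apply, rdiv, hwe s hs])
    refine hs'.congr_deriv ?_
    have mo := sol.momentum r hr t ht
    have ma := sol.mass r hr t ht
    have d1 : deriv (fun τ => ρ r τ * u r τ) t
        = deriv (fun τ => ρ r τ) t * u r t + ρ r t * deriv (fun τ => u r τ) t :=
      deriv_fun_mul ((hqt r).differentiable (by norm_num) t) ((hvt r).differentiable (by norm_num) t)
    have d2 : deriv (fun s => ρ s t * u s t ^ 2) r
        = deriv (fun s => ρ s t * u s t) r * u r t
          + ρ r t * u r t * deriv (fun s => u s t) r := by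
      have : (fun s => ρ s t * u s t ^ 2) = fun s => (ρ s t * u s t) * u s t := by
        funext s
        ring
      rw [this]
      exact deriv_fun_mul ((hdq r).mul (hdv r)) (hdv r)
    rw [d1, d2] at mo
    have ma2 : (deriv (fun τ => ρ r τ) t + deriv (fun s => ρ s t * u s t) r
      + ρ r t * u r t / r) * u r t = 0 := by rw [ma]; ring
    rw [← mo]
    simp only [mder]
    have : ρ r t * u r t ^ 2 / r = ρ r t * u r t / r * u r t := by ring
    rw [this]
    linarith

set_option maxHeartbeats 4000000 in
/-- **`L⁴` estimate of `∇u`.** If `‖ρ‖_{L^∞} ≤ C₀`, then there is a constant `C` depending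
only on `C₀, μ, β, γ, Ω` and the initial data such that at each time
`‖∇u‖₄⁴ ≤ C + C(‖∇u‖₂² + 1)(‖√ρ u̇‖₂² + ∫_Ω F²/(2μ+λ) dx)`. -/
theorem gradu_L4_estimate
    (μ β γ R C₀ : ℝ) (ρ₀ u₀ : ℝ → ℝ)
    (hμ : 0 < μ) (hβ : 1 < β) (hγ : 1 < γ) (hR : 0 < R) (hC₀ : 0 < C₀) :
    ∃ C > 0, ∀ T > 0, ∀ ρ u : ℝ → ℝ → ℝ,
      RadialSolution μ β γ R T ρ u →
      (∀ r ∈ Icc (0:ℝ) R, ρ r 0 = ρ₀ r ∧ u r 0 = u₀ r) →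
      (∀ r ∈ Icc (0:ℝ) R, ∀ t ∈ Icc (0:ℝ) T, ρ r t ≤ C₀) →
      ∀ t ∈ Icc (0:ℝ) T,
        2 * Real.pi * (∫ r in Ioo (0:ℝ) R, (gradSq u r t) ^ 2 * r)
          ≤ C + C * (2 * Real.pi * (∫ r in Ioo (0:ℝ) R, gradSq u r t * r) + 1) *
              (2 * Real.pi * (∫ r in Ioo (0:ℝ) R, ρ r t * (mder u r t) ^ 2 * r)
                + 2 * Real.pi * (∫ r in Ioo (0:ℝ) R,
                    (flux μ β γ ρ u r t) ^ 2 / (2 * μ + ρ r t ^ β) * r)) := by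
  set Λ := 2 * μ + C₀ ^ β with hΛ
  set P := C₀ ^ γ with hP
  have hΛ0 : 0 < Λ := by positivity
  have hP0 : 0 < P := by positivity
  set k1 := 22 * (8 / (2 * μ) ^ 4) with hk1
  set k2 := 8 / R ^ 2 + 22 with hk2
  set k3 := P ^ 4 * (R ^ 2 / 2) with hk3
  set k4 := 4 * Λ ^ 2 + P ^ 2 * R ^ 2 with hk4
  set k5 := Λ + C₀ with hk5
  have hk1p : 0 < k1 := by positivity
  have hk2p : 0 < k2 := by positivity
  have hk3p : 0 < k3 := by positivity
  have hk4p : 0 < k4 := by positivity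
  have hk5p : 0 < k5 := by positivity
  have hpi := Real.pi_gt_three
  clear_value k1 k4 k5 Λ
  refine ⟨2 * Real.pi * (k1 * k3) + 2 * Real.pi * (k1 * k2 * k4 * k5), by positivity, ?_⟩
  intro T hT ρ u sol _ hub t ht
  obtain ⟨w, G, G', v', q, m, hv', hw, hGc, hG'c, hq, hm, hd, hvw, hdG, hv'e, hwe, hqe, hme, hG, hG'⟩ :=
    radial_data sol ht
  have conv : ∀ f g : ℝ → ℝ, (∀ r ∈ Ioo 0 R, f r = g r) →
      (∫ r in Ioo (0:ℝ) R, f r) = ∫ r in (0:ℝ)..R, g r := by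
    intro f g h
    rw [intervalIntegral.integral_of_le hR.le, integral_Ioc_eq_integral_Ioo]
    exact setIntegral_congr_fun measurableSet_Ioo h
  have gs : ∀ r ∈ Ioo 0 R, gradSq u r t = v' r ^ 2 + w r ^ 2 := by
    intro r hr
    rw [gradSq, hv'e r, hwe r hr]
  have fl : ∀ r ∈ Ioo 0 R, flux μ β γ ρ u r t = G r := by
    intro r hr
    rw [flux, rdiv, hG r, hv'e r, hwe r hr, hqe r]
  rw [conv _ (fun r => (v' r ^ 2 + w r ^ 2) ^ 2 * r) (fun r hr => by rw [gs r hr]),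
    conv _ (fun r => (v' r ^ 2 + w r ^ 2) * r) (fun r hr => by rw [gs r hr]),
    conv _ (fun r => q r * m r ^ 2 * r) (fun r hr => by rw [hqe, hme]),
    conv _ (fun r => G r ^ 2 / (2 * μ + q r ^ β) * r) (fun r hr => by rw [fl r hr, hqe])]
  have hqpos : ∀ r ∈ Icc 0 R, 0 < q r := fun r hr => by rw [← hqe]; exact sol.ρ_pos r hr t ht
  have hqle : ∀ r ∈ Icc 0 R, q r ≤ C₀ := fun r hr => by rw [← hqe]; exact hub r hr t ht
  have hden : ∀ r ∈ Icc 0 R, 2 * μ ≤ 2 * μ + q r ^ β := fun r hr => by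
    have := Real.rpow_nonneg (hqpos r hr).le β
    linarith
  have hden2 : ∀ r ∈ Icc 0 R, 2 * μ + q r ^ β ≤ Λ := fun r hr => by
    have := Real.rpow_le_rpow (hqpos r hr).le (hqle r hr) (by linarith : 0 ≤ β)
    linarith
  have hPq : ∀ r ∈ Icc 0 R, q r ^ γ ≤ P := fun r hr =>
    Real.rpow_le_rpow (hqpos r hr).le (hqle r hr) (by linarith : 0 ≤ γ)
  have hPq0 : ∀ r ∈ Icc 0 R, 0 ≤ q r ^ γ := fun r hr => Real.rpow_nonneg (hqpos r hr).le γ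
  have lad := radial_lady hR hGc hG'c hdG
  have ell := radial_elliptic hR hv' hw hd hvw
  set S4 := ∫ r in (0:ℝ)..R, (v' r ^ 2 + w r ^ 2) ^ 2 * r with hS4
  set S2 := ∫ r in (0:ℝ)..R, (v' r ^ 2 + w r ^ 2) * r with hS2
  set A := ∫ r in (0:ℝ)..R, q r * m r ^ 2 * r with hA
  set B := ∫ r in (0:ℝ)..R, G r ^ 2 / (2 * μ + q r ^ β) * r with hB
  set a := ∫ r in (0:ℝ)..R, G r ^ 2 * r with ha
  set b := ∫ r in (0:ℝ)..R, G' r ^ 2 * r with hb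
  set D4 := ∫ r in (0:ℝ)..R, (v' r + w r) ^ 4 * r with hD4
  set G4 := ∫ r in (0:ℝ)..R, G r ^ 4 * r with hG4
  have hint : (∫ r in (0:ℝ)..R, r) = R ^ 2 / 2 := by rw [integral_id]; ring
  have hβ0 : 0 ≤ β := by linarith
  have hBi : IntervalIntegrable (fun r => G r ^ 2 / (2 * μ + q r ^ β) * r) volume 0 R := by
    apply ContinuousOn.intervalIntegrable
    rw [uIcc_of_le hR.le]
    have hqβ : Continuous fun r => q r ^ β := hq.rpow_const fun _ => Or.inr hβ0
    refine ContinuousOn.mul (ContinuousOn.div (by fun_prop) (by fun_prop) ?_) (by fun_prop)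
    intro r hr
    have := hden r hr
    linarith
  have hS20 : 0 ≤ S2 := intervalIntegral.integral_nonneg hR.le fun r hr => by
    have := hr.1
    positivity
  have ha0 : 0 ≤ a := intervalIntegral.integral_nonneg hR.le fun r hr => by
    have := hr.1
    positivity
  have hb0 : 0 ≤ b := intervalIntegral.integral_nonneg hR.le fun r hr => by
    have := hr.1
    positivity
  have hA0 : 0 ≤ A := intervalIntegral.integral_nonneg hR.le fun r hr => by
    have := hr.1
    have := hqpos r hr
    positivity
  have hB0 : 0 ≤ B := intervalIntegral.integral_nonneg hR.le fun r hr => by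
    have := hr.1
    have := hden r hr
    have : 0 < 2 * μ + q r ^ β := by linarith
    positivity
  -- a in terms of B
  have haB : a ≤ Λ * B := by
    rw [hB, ← intervalIntegral.integral_const_mul]
    apply ii_mono hR
    · apply Continuous.intervalIntegrable; fun_prop
    · exact hBi.const_mul _
    intro r hr
    have hr' := Ioo_subset_Icc_self hr
    have h1 := hden r hr'
    have h2 := hden2 r hr'
    have h3 : 0 < 2 * μ + q r ^ β := by linarith
    rw [← mul_assoc]
    apply mul_le_mul_of_nonneg_right _ hr.1.le
    rw [mul_div_assoc', le_div_iff₀ h3, mul_comm]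
    exact mul_le_mul_of_nonneg_right h2 (sq_nonneg _)
  have hbA : b ≤ C₀ * A := by
    rw [hA, ← intervalIntegral.integral_const_mul]
    apply ii_mono hR
    · apply Continuous.intervalIntegrable; fun_prop
    · apply Continuous.intervalIntegrable; fun_prop
    intro r hr
    have hr' := Ioo_subset_Icc_self hr
    rw [hG' r, ← mul_assoc]
    apply mul_le_mul_of_nonneg_right _ hr.1.le
    have : q r * (q r * m r ^ 2) ≤ C₀ * (q r * m r ^ 2) :=
      mul_le_mul_of_nonneg_right (hqle r hr') (mul_nonneg (hqpos r hr').le (sq_nonneg _))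
    linarith
  have haS : a ≤ k4 * (S2 + 1) := by
    have : a ≤ ∫ r in (0:ℝ)..R, ((4 * Λ ^ 2) * ((v' r ^ 2 + w r ^ 2) * r) + (2 * P ^ 2) * r) := by
      apply ii_mono hR
      · apply Continuous.intervalIntegrable; fun_prop
      · apply Continuous.intervalIntegrable; fun_prop
      intro r hr
      have hr' := Ioo_subset_Icc_self hr
      have h1 := hden r hr'
      have h2 := hden2 r hr'
      have h3 : 0 < 2 * μ + q r ^ β := by linarith
      have h4 : G r ^ 2 ≤ 4 * Λ ^ 2 * (v' r ^ 2 + w r ^ 2) + 2 * P ^ 2 := by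
        rw [hG r]
        have e1 : (2 * μ + q r ^ β) ^ 2 ≤ Λ ^ 2 := by gcongr
        have e2 : (q r ^ γ) ^ 2 ≤ P ^ 2 := by
          have := hPq0 r hr'
          have := hPq r hr'
          gcongr
        have e3 : (v' r + w r) ^ 2 ≤ 2 * (v' r ^ 2 + w r ^ 2) := by
          nlinarith [sq_nonneg (v' r - w r)]
        have e4 : (2 * μ + q r ^ β) ^ 2 * (v' r + w r) ^ 2 ≤ Λ ^ 2 * (2 * (v' r ^ 2 + w r ^ 2)) := by
          gcongr
        nlinarith [sq_nonneg ((2 * μ + q r ^ β) * (v' r + w r) + q r ^ γ)]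
      have := mul_le_mul_of_nonneg_right h4 hr.1.le
      linarith
    rw [intervalIntegral.integral_add, intervalIntegral.integral_const_mul,
      intervalIntegral.integral_const_mul, hint] at this
    · refine this.trans ?_
      rw [hk4]
      have h5 : 0 ≤ P ^ 2 * R ^ 2 * S2 := by positivity
      have h6 : 0 ≤ Λ ^ 2 := sq_nonneg _
      simp only [← hS2]
      linarith
    all_goals (apply Continuous.intervalIntegrable; fun_prop)
  have hDG : D4 ≤ 8 / (2 * μ) ^ 4 * (G4 + k3) := by
    have : D4 ≤ ∫ r in (0:ℝ)..R, (8 / (2 * μ) ^ 4) * (G r ^ 4 * r + P ^ 4 * r) := by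
      apply ii_mono hR
      · apply Continuous.intervalIntegrable; fun_prop
      · apply Continuous.intervalIntegrable; fun_prop
      intro r hr
      have hr' := Ioo_subset_Icc_self hr
      have h1 := hden r hr'
      have e0 := hPq0 r hr'
      have e1 := hPq r hr'
      have h4 : (v' r + w r) ^ 4 ≤ 8 / (2 * μ) ^ 4 * (G r ^ 4 + P ^ 4) := by
        rw [div_mul_eq_mul_div, le_div_iff₀ (by positivity)]
        have e2 : (2 * μ) ^ 4 ≤ (2 * μ + q r ^ β) ^ 4 := by gcongr
        have e3 : (v' r + w r) ^ 4 * (2 * μ) ^ 4 ≤ (G r + q r ^ γ) ^ 4 := by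
          have : G r + q r ^ γ = (v' r + w r) * (2 * μ + q r ^ β) := by rw [hG r]; ring
          rw [this, mul_pow (v' r + w r)]
          exact mul_le_mul_of_nonneg_left e2 (by positivity)
        have e4 : (q r ^ γ) ^ 4 ≤ P ^ 4 := by gcongr
        have e5 : (G r + q r ^ γ) ^ 4 ≤ 8 * (G r ^ 4 + (q r ^ γ) ^ 4) := by
          have := add_pow_le_pow_four (G r) (q r ^ γ)
          linarith
        linarith
      have := mul_le_mul_of_nonneg_right h4 hr.1.le
      linarith
    rw [intervalIntegral.integral_const_mul, intervalIntegral.integral_add,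
      intervalIntegral.integral_const_mul, hint] at this
    · exact this
    all_goals (apply Continuous.intervalIntegrable; fun_prop)
  clear_value S4 S2 A B a b D4 G4 k3 P
  have hab : a + b ≤ k5 * (A + B) := by
    rw [hk5]
    nlinarith [mul_nonneg hΛ0.le hA0, mul_nonneg hC₀.le hB0]
  have hprod : a * (a + b) ≤ (k4 * (S2 + 1)) * (k5 * (A + B)) := by gcongr
  have hS4 : S4 ≤ k1 * k3 + (k1 * k2 * k4 * k5) * ((S2 + 1) * (A + B)) := by
    have e1 : S4 ≤ k1 * (G4 + k3) := by rw [hk1]; linarith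
    have e2 : G4 ≤ k2 * ((k4 * (S2 + 1)) * (k5 * (A + B))) := by
      calc G4 ≤ k2 * a * (a + b) := lad
        _ = k2 * (a * (a + b)) := by ring
        _ ≤ _ := mul_le_mul_of_nonneg_left hprod hk2p.le
    calc S4 ≤ k1 * (G4 + k3) := e1
      _ ≤ k1 * (k2 * ((k4 * (S2 + 1)) * (k5 * (A + B))) + k3) := by gcongr
      _ = _ := by ring
  have hX : (S2 + 1) * (A + B) ≤ (2 * Real.pi * S2 + 1) * (2 * Real.pi * A + 2 * Real.pi * B) := by
    have x1 : S2 ≤ 2 * Real.pi * S2 := by nlinarith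
    have x2 : A ≤ 2 * Real.pi * A := by nlinarith
    have x3 : B ≤ 2 * Real.pi * B := by nlinarith
    gcongr
  set X := (2 * Real.pi * S2 + 1) * (2 * Real.pi * A + 2 * Real.pi * B) with hXd
  have hX0 : 0 ≤ X := by positivity
  have hL : 2 * Real.pi * S4 ≤ 2 * Real.pi * (k1 * k3 + (k1 * k2 * k4 * k5) * X) := by gcongr; exact hS4.trans (by gcongr)
  rw [mul_assoc (2 * Real.pi * (k1 * k3) + 2 * Real.pi * (k1 * k2 * k4 * k5)), ← hXd]
  have z1 : 0 ≤ 2 * Real.pi * (k1 * k3) * X := by positivity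
  have z2 : 0 ≤ 2 * Real.pi * (k1 * k2 * k4 * k5) := by positivity
  linarith
end
end

section
/- Let (ρ, u) be a radially symmetric strong solution on [0,R] × [0,T] with ‖ρ‖_{L^∞(Ω×(0,T))} ≤ C₀, and let F = (2μ + ρ^β)(u_r + u/r) − ρ^γ and λ = ρ^β. Then there is a constant C depending only on C₀, μ, β, γ and Ω such that for all t ∈ (0,T), (1/2)(d/dt) ∫_Ω F²/(2μ+λ) dx + ∫_Ω ρ |u̇|² dx ≤ C + C ‖∇u‖_{L⁴(Ω)}⁴, where u̇ = u_t + u u_r. -/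
open MeasureTheory Set Filter

noncomputable section

lemma partials (f : ℝ → ℝ → ℝ) (hf : ∀ n : ℕ, ContDiff ℝ n (Function.uncurry f)) :
    ∃ fr ft frr frt : ℝ → ℝ → ℝ,
      Continuous (Function.uncurry f) ∧
      Continuous (Function.uncurry fr) ∧ Continuous (Function.uncurry ft) ∧
      Continuous (Function.uncurry frr) ∧ Continuous (Function.uncurry frt) ∧
      (∀ r t, HasDerivAt (fun s => f s t) (fr r t) r) ∧
      (∀ r t, HasDerivAt (fun τ => f r τ) (ft r t) t) ∧
      (∀ r t, HasDerivAt (fun s => fr s t) (frr r t) r) ∧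
      (∀ r t, HasDerivAt (fun τ => fr r τ) (frt r t) t) ∧
      (∀ r t, HasDerivAt (fun s => ft s t) (frt r t) r) := by
  set g := Function.uncurry f with hg
  have h1 : Differentiable ℝ g := (hf 1).differentiable (by norm_num)
  have h2 : ContDiff ℝ 1 (fderiv ℝ g) := (hf 2).fderiv_right (by norm_num)
  have h2d : Differentiable ℝ (fderiv ℝ g) := h2.differentiable (by norm_num)
  have h3 : Continuous (fderiv ℝ (fderiv ℝ g)) := h2.continuous_fderiv (by norm_num)
  have cr : ∀ r t : ℝ, HasDerivAt (fun s : ℝ => (s, t)) ((1 : ℝ), (0 : ℝ)) r := fun r t =>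
    (hasDerivAt_id r).prodMk (hasDerivAt_const r t)
  have ct : ∀ r t : ℝ, HasDerivAt (fun s : ℝ => (r, s)) ((0 : ℝ), (1 : ℝ)) t := fun r t =>
    (hasDerivAt_const t r).prodMk (hasDerivAt_id t)
  have gen : ∀ e v : ℝ × ℝ, ∀ (c : ℝ → ℝ × ℝ) (x : ℝ), HasDerivAt c v x →
      HasDerivAt (fun s => fderiv ℝ g (c s) e) (fderiv ℝ (fderiv ℝ g) (c x) v e) x := by
    intro e v c x hc
    have := ((h2d (c x)).hasFDerivAt.comp_hasDerivAt x hc).clm_apply (hasDerivAt_const x e)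
    simpa using this
  refine ⟨fun r t => fderiv ℝ g (r, t) (1, 0), fun r t => fderiv ℝ g (r, t) (0, 1),
    fun r t => fderiv ℝ (fderiv ℝ g) (r, t) (1, 0) (1, 0),
    fun r t => fderiv ℝ (fderiv ℝ g) (r, t) (0, 1) (1, 0), h1.continuous, ?_, ?_, ?_, ?_,
    ?_, ?_, ?_, ?_, ?_⟩
  · exact h2.continuous.clm_apply continuous_const
  · exact h2.continuous.clm_apply continuous_const
  · exact (h3.clm_apply continuous_const).clm_apply continuous_const
  · exact (h3.clm_apply continuous_const).clm_apply continuous_const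
  · intro r t
    exact (h1 (r, t)).hasFDerivAt.comp_hasDerivAt r (cr r t)
  · intro r t
    exact (h1 (r, t)).hasFDerivAt.comp_hasDerivAt t (ct r t)
  · intro r t
    exact gen _ _ _ _ (cr r t)
  · intro r t
    exact gen _ _ _ _ (ct r t)
  · intro r t
    have hs : IsSymmSndFDerivAt ℝ g (r, t) :=
      (hf 2).contDiffAt.isSymmSndFDerivAt (by simp)
    have := gen (0, 1) _ _ _ (cr r t)
    rw [hs.eq] at this
    exact this

lemma quot_cont (u ur : ℝ → ℝ → ℝ) (hc : Continuous (Function.uncurry ur))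
    (hd : ∀ r t, HasDerivAt (fun s => u s t) (ur r t) r) :
    ∃ w : ℝ → ℝ → ℝ, Continuous (Function.uncurry w) ∧
      ∀ r t, u 0 t = 0 → u r t = w r t * r := by
  refine ⟨fun r t => ∫ s in (0:ℝ)..1, ur (s * r) t, ?_, ?_⟩
  · apply intervalIntegral.continuous_parametric_intervalIntegral_of_continuous'
      (f := fun (p : ℝ × ℝ) s => ur (s * p.1) p.2)
    exact hc.comp (by fun_prop : Continuous fun q : (ℝ × ℝ) × ℝ => (q.2 * q.1.1, q.1.2))
  · intro r t h0
    have h1 : (∫ s in (0:ℝ)..1, ur (s * r) t * r) = u (1 * r) t - u (0 * r) t := by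
      apply intervalIntegral.integral_eq_sub_of_hasDerivAt (f := fun s => u (s * r) t)
      · intro x _
        have := (hd (x * r) t).comp x ((hasDerivAt_id x).mul_const r)
        simpa [Function.comp_def] using this
      · apply Continuous.intervalIntegrable
        exact (hc.comp (by fun_prop : Continuous fun s : ℝ => (s * r, t))).mul continuous_const
    rw [intervalIntegral.integral_mul_const] at h1
    simp [h0] at h1
    simp [h1]

lemma deriv_int (R T : ℝ) (G H : ℝ → ℝ → ℝ)
    (hG : ContinuousOn (Function.uncurry G) (Icc 0 R ×ˢ Icc 0 T))
    (hH : ContinuousOn (Function.uncurry H) (Icc 0 R ×ˢ Icc 0 T))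
    (hd : ∀ r ∈ Ioo 0 R, ∀ τ ∈ Ioo 0 T, HasDerivAt (fun τ => G r τ) (H r τ) τ)
    (t : ℝ) (ht : t ∈ Ioo 0 T) :
    HasDerivAt (fun τ => ∫ r in Ioo 0 R, G r τ) (∫ r in Ioo 0 R, H r t) t := by
  obtain ⟨B, hB⟩ := (isCompact_Icc.prod isCompact_Icc).exists_bound_of_continuousOn hH
  have slice : ∀ K : ℝ → ℝ → ℝ, ContinuousOn (Function.uncurry K) (Icc 0 R ×ˢ Icc 0 T) →
      ∀ τ ∈ Ioo 0 T, IntegrableOn (fun r => K r τ) (Ioo 0 R) := by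
    intro K hK τ hτ
    have : ContinuousOn (fun r => K r τ) (Icc 0 R) :=
      hK.comp (f := fun r : ℝ => (r, τ)) (by fun_prop)
        (fun r hr => ⟨hr, Ioo_subset_Icc_self hτ⟩)
    exact (this.integrableOn_compact isCompact_Icc).mono_set Ioo_subset_Icc_self
  refine (hasDerivAt_integral_of_dominated_loc_of_deriv_le (μ := volume.restrict (Ioo 0 R))
    (F := fun τ r => G r τ) (F' := fun τ r => H r τ) (s := Ioo 0 T) (bound := fun _ => B)
    (Ioo_mem_nhds ht.1 ht.2) ?_ (slice G hG t ht) (slice H hH t ht).aestronglyMeasurable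
    ?_ ?_ ?_).2
  · filter_upwards [Ioo_mem_nhds ht.1 ht.2] with τ hτ
    exact (slice G hG τ hτ).aestronglyMeasurable
  · filter_upwards [ae_restrict_mem measurableSet_Ioo] with r hr τ hτ
    exact hB (r, τ) ⟨Ioo_subset_Icc_self hr, Ioo_subset_Icc_self hτ⟩
  · exact integrable_const _
  · filter_upwards [ae_restrict_mem measurableSet_Ioo] with r hr τ hτ
    exact hd r hr τ hτ

lemma int_split (S : Set ℝ) (A B D : ℝ → ℝ) (hA : IntegrableOn A S) (hB : IntegrableOn B S)
    (hD : IntegrableOn D S) :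
    ∫ r in S, (1 / 2 * A r + B r - D r) = 1 / 2 * (∫ r in S, A r) + (∫ r in S, B r)
      - ∫ r in S, D r := by
  have h1 : Integrable (fun r => 1 / 2 * A r) (volume.restrict S) := hA.const_mul _
  have h2 : Integrable (fun r => 1 / 2 * A r + B r) (volume.restrict S) := h1.add hB
  rw [integral_sub h2 hD, integral_add h1 hB, integral_const_mul]

lemma alg_id (μ β γ r a at' ar ur urr urt w v lam P lp pp : ℝ) (hr : r ≠ 0)
    (hκ : 2 * μ + lam ≠ 0)
    (mass : at' + ar * (w * r) + a * (ur + w) = 0)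
    (mom : lp * ar * (ur + w) + (2 * μ + lam) * (urr + (ur - w) / r) - pp * ar
      = a * (v * r + w * r * ur))
    (e3 : a * lp = β * lam) (e4 : a * pp = γ * P) :
    (1 / 2) * ((2 * ((2 * μ + lam) * (ur + w) - P)
        * (lp * at' * (ur + w) + (2 * μ + lam) * (urt + v) - pp * at') / (2 * μ + lam)
        - ((2 * μ + lam) * (ur + w) - P) ^ 2 * (lp * at') / (2 * μ + lam) ^ 2) * r)
      + a * (v * r + w * r * ur) ^ 2 * r
      - (((2 * μ + lam) * (ur + w) - P) ^ 2 / (2 * μ + lam) * (ur + w) / 2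
        - ((2 * μ + lam) * (ur + w) - P) ^ 2 * (β * lam) * (ur + w) / (2 * μ + lam) ^ 2 / 2
        + ((2 * μ + lam) * (ur + w) - P) * (γ * P * (2 * μ + lam) - β * P * lam)
            / (2 * μ + lam) ^ 2 * (ur + w)
        - ((2 * μ + lam) * (ur + w) - P) * (ur ^ 2 + w ^ 2)) * r
    = (a * (v * r + w * r * ur)) * ((v * r + w * r * ur) * r)
      + ((2 * μ + lam) * (ur + w) - P) *
          ((urt + (ur * ur + w * r * urr)) * r + (v * r + w * r * ur))
      - (1 / 2) * (((ur * r + w * r) * (((2 * μ + lam) * (ur + w) - P) ^ 2 / (2 * μ + lam)))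
        + (w * r * r) * (2 * ((2 * μ + lam) * (ur + w) - P) * (a * (v * r + w * r * ur))
            / (2 * μ + lam) - ((2 * μ + lam) * (ur + w) - P) ^ 2 * (lp * ar)
              / (2 * μ + lam) ^ 2)) := by
  linear_combination (norm := (field_simp; ring))
    (r * ((2 * μ + lam) * (ur + w) - P) * (lp * (ur + w) - pp) / (2 * μ + lam)
      - (1 / 2) * r * ((2 * μ + lam) * (ur + w) - P) ^ 2 * lp / (2 * μ + lam) ^ 2) * mass
    - (w * r ^ 2 * ((2 * μ + lam) * (ur + w) - P) / (2 * μ + lam)) * mom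
    + (- r * ((2 * μ + lam) * (ur + w) - P) * (ur + w) ^ 2 / (2 * μ + lam)
      + (1 / 2) * r * ((2 * μ + lam) * (ur + w) - P) ^ 2 * (ur + w) / (2 * μ + lam) ^ 2) * e3
    + (r * ((2 * μ + lam) * (ur + w) - P) * (ur + w) / (2 * μ + lam)) * e4

lemma bound_Q (μ β γ L M ur w lam P : ℝ) (hμ : 0 < μ) (hβ : 1 < β) (hγ : 1 < γ)
    (hl0 : 0 ≤ lam) (hl : lam ≤ L) (hP0 : 0 ≤ P) (hP : P ≤ M) :
    ((2 * μ + lam) * (ur + w) - P) ^ 2 / (2 * μ + lam) * (ur + w) / 2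
        - ((2 * μ + lam) * (ur + w) - P) ^ 2 * (β * lam) * (ur + w) / (2 * μ + lam) ^ 2 / 2
        + ((2 * μ + lam) * (ur + w) - P) * (γ * P * (2 * μ + lam) - β * P * lam)
            / (2 * μ + lam) ^ 2 * (ur + w)
        - ((2 * μ + lam) * (ur + w) - P) * (ur ^ 2 + w ^ 2)
    ≤ 40 * ((2 * μ + L + M) ^ 2 / (2 * μ) * (1 + β)
        + (2 * μ + L + M) * (M / (2 * μ) * (γ + β)) + (2 * μ + L + M))
      * (1 + (ur ^ 2 + w ^ 2) ^ 2) := by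
  have hκ : 0 < 2 * μ + lam := by positivity
  set κ := 2 * μ + lam with hk
  set D := ur + w with hD
  set F := κ * D - P with hF
  set g := ur ^ 2 + w ^ 2 with hg
  set N := 2 * μ + L + M with hN
  have hM : 0 ≤ M := hP0.trans hP
  have hL : 0 ≤ L := hl0.trans hl
  have hN0 : 0 < N := by positivity
  have hg0 : 0 ≤ g := by positivity
  set y := 1 + |D| with hy
  have hy1 : 1 ≤ y := by simp [hy]
  have hDy : |D| ≤ y := by simp [hy]
  have hFy : |F| ≤ N * y := by
    calc |F| ≤ |κ * D| + |P| := abs_sub _ _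
      _ = κ * |D| + P := by rw [abs_mul, abs_of_pos hκ, abs_of_nonneg hP0]
      _ ≤ N * |D| + N * 1 := by
          have : κ ≤ N := by linarith
          have h2 : P ≤ N * 1 := by linarith
          gcongr
      _ = N * y := by rw [hy]; ring
  have hq0 : 0 ≤ lam / κ := by positivity
  have hq1 : lam / κ ≤ 1 := by rw [div_le_one hκ]; linarith
  have hb0 : 0 ≤ β * (lam / κ) := by positivity
  have hb1 : β * (lam / κ) ≤ β := mul_le_of_le_one_right (by linarith) hq1
  have hi : 1 / κ ≤ 1 / (2 * μ) := one_div_le_one_div_of_le (by positivity) (by linarith)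
  have hF2 : F ^ 2 ≤ N ^ 2 * y ^ 2 := by
    rw [← sq_abs F, ← mul_pow]; gcongr
  -- first two terms
  have t12 : F ^ 2 / κ * D / 2 - F ^ 2 * (β * lam) * D / κ ^ 2 / 2
      ≤ N ^ 2 / (2 * μ) * (1 + β) * y ^ 4 := by
    have e : F ^ 2 / κ * D / 2 - F ^ 2 * (β * lam) * D / κ ^ 2 / 2
        = F ^ 2 * (1 / κ) * ((1 - β * (lam / κ)) / 2) * D := by field_simp
    rw [e]
    have hb : |(1 - β * (lam / κ)) / 2| ≤ 1 + β := by
      rw [abs_le]; constructor <;> linarith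
    calc F ^ 2 * (1 / κ) * ((1 - β * (lam / κ)) / 2) * D
        ≤ |F ^ 2 * (1 / κ) * ((1 - β * (lam / κ)) / 2) * D| := le_abs_self _
      _ = F ^ 2 * (1 / κ) * |(1 - β * (lam / κ)) / 2| * |D| := by
          rw [abs_mul, abs_mul, abs_of_nonneg (by positivity : 0 ≤ F ^ 2 * (1 / κ))]
      _ ≤ (N ^ 2 * y ^ 2) * (1 / (2 * μ)) * (1 + β) * y := by gcongr
      _ = N ^ 2 / (2 * μ) * (1 + β) * y ^ 3 := by ring
      _ ≤ N ^ 2 / (2 * μ) * (1 + β) * y ^ 4 := by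
          gcongr ?_ * ?_
          exact pow_le_pow_right₀ hy1 (by norm_num)
  have t3 : F * (γ * P * κ - β * P * lam) / κ ^ 2 * D ≤ N * (M / (2 * μ) * (γ + β)) * y ^ 4 := by
    have e : F * (γ * P * κ - β * P * lam) / κ ^ 2 * D
        = F * (P * (1 / κ) * (γ - β * (lam / κ))) * D := by field_simp
    rw [e]
    have hb : |γ - β * (lam / κ)| ≤ γ + β := by
      rw [abs_le]; constructor <;> linarith
    calc F * (P * (1 / κ) * (γ - β * (lam / κ))) * D
        ≤ |F * (P * (1 / κ) * (γ - β * (lam / κ))) * D| := le_abs_self _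
      _ = |F| * (P * (1 / κ) * |γ - β * (lam / κ)|) * |D| := by
          rw [abs_mul, abs_mul, abs_mul, abs_of_nonneg (by positivity : 0 ≤ P * (1 / κ))]
      _ ≤ (N * y) * (M * (1 / (2 * μ)) * (γ + β)) * y := by gcongr
      _ = N * (M / (2 * μ) * (γ + β)) * y ^ 2 := by ring
      _ ≤ N * (M / (2 * μ) * (γ + β)) * y ^ 4 := by
          gcongr ?_ * ?_
          exact pow_le_pow_right₀ hy1 (by norm_num)
  have hy24 : y ^ 2 ≤ y ^ 4 := pow_le_pow_right₀ hy1 (by norm_num)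
  have t4 : -(F * g) ≤ N * (y ^ 4 + g ^ 2) := by
    have : -F ≤ N * y := (neg_le_abs F).trans hFy
    have h2 : y * g ≤ y ^ 4 + g ^ 2 := by
      have h3 := two_mul_le_add_sq y g
      have h4 : 0 ≤ y * g := by positivity
      linarith
    calc -(F * g) = (-F) * g := by ring
      _ ≤ (N * y) * g := by gcongr
      _ = N * (y * g) := by ring
      _ ≤ _ := by gcongr
  have hy4 : y ^ 4 ≤ 8 + 32 * g ^ 2 := by
    have h1 : y ^ 2 ≤ 2 + 4 * g := by
      have : y ^ 2 ≤ 2 + 2 * D ^ 2 := by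
        rw [hy, ← sq_abs D]; linarith [sq_nonneg (1 - |D|)]
      have h2 : D ^ 2 ≤ 2 * g := by rw [hD, hg]; linarith [sq_nonneg (ur - w)]
      linarith
    have h3 : (y ^ 2) ^ 2 ≤ (2 + 4 * g) ^ 2 := by gcongr
    have h4 : (y ^ 2) ^ 2 = y ^ 4 := by ring
    linarith [sq_nonneg (2 - 4 * g)]
  set A1 := N ^ 2 / (2 * μ) * (1 + β)
  set A2 := N * (M / (2 * μ) * (γ + β))
  have hA1 : 0 ≤ A1 := by positivity
  have hA2 : 0 ≤ A2 := by positivity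
  have h5 : (A1 + A2 + N) * y ^ 4 ≤ (A1 + A2 + N) * (8 + 32 * g ^ 2) := by gcongr
  have : 0 ≤ (A1 + A2) * g ^ 2 := by positivity
  have h6 : 0 ≤ A1 + A2 + N := by positivity
  have h7 : 0 ≤ N * g ^ 2 := by positivity
  linarith

/-- `F²/(2μ+λ)` in terms of pointwise values. -/
def Gx (μ ur w lam P : ℝ) : ℝ := ((2 * μ + lam) * (ur + w) - P) ^ 2 / (2 * μ + lam)

/-- Time derivative of `F²/(2μ+λ)` in terms of pointwise values. -/
def Hx (μ at' ur urt w v lam P lp pp : ℝ) : ℝ :=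
  2 * ((2 * μ + lam) * (ur + w) - P)
        * (lp * at' * (ur + w) + (2 * μ + lam) * (urt + v) - pp * at') / (2 * μ + lam)
        - ((2 * μ + lam) * (ur + w) - P) ^ 2 * (lp * at') / (2 * μ + lam) ^ 2

/-- The remainder terms. -/
def Qx (μ β γ ur w lam P : ℝ) : ℝ :=
  ((2 * μ + lam) * (ur + w) - P) ^ 2 / (2 * μ + lam) * (ur + w) / 2
        - ((2 * μ + lam) * (ur + w) - P) ^ 2 * (β * lam) * (ur + w) / (2 * μ + lam) ^ 2 / 2
        + ((2 * μ + lam) * (ur + w) - P) * (γ * P * (2 * μ + lam) - β * P * lam)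
            / (2 * μ + lam) ^ 2 * (ur + w)
        - ((2 * μ + lam) * (ur + w) - P) * (ur ^ 2 + w ^ 2)

lemma cont_G (S : Set (ℝ × ℝ)) (μ : ℝ) (ur w lam P : ℝ × ℝ → ℝ) (h1 : Continuous ur)
    (h2 : Continuous w) (h3 : Continuous lam) (h4 : Continuous P)
    (k0 : ∀ p ∈ S, 2 * μ + lam p ≠ 0) :
    ContinuousOn (fun p => Gx μ (ur p) (w p) (lam p) (P p) * p.1) S := by
  unfold Gx
  fun_prop (disch := assumption)

lemma cont_H (S : Set (ℝ × ℝ)) (μ : ℝ) (at' ur urt w v lam P lp pp : ℝ × ℝ → ℝ)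
    (h0 : Continuous at') (h1 : Continuous ur) (h5 : Continuous urt)
    (h2 : Continuous w) (h6 : Continuous v) (h3 : Continuous lam) (h4 : Continuous P)
    (h7 : Continuous lp) (h8 : Continuous pp)
    (k0 : ∀ p ∈ S, 2 * μ + lam p ≠ 0) :
    ContinuousOn (fun p => Hx μ (at' p) (ur p) (urt p) (w p) (v p) (lam p) (P p) (lp p) (pp p)
      * p.1) S := by
  unfold Hx
  have k1 : ∀ p ∈ S, (2 * μ + lam p) ^ 2 ≠ 0 := fun p hp => pow_ne_zero 2 (k0 p hp)
  fun_prop (disch := assumption)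

lemma cont_Q (S : Set (ℝ × ℝ)) (μ β γ : ℝ) (ur w lam P : ℝ × ℝ → ℝ) (h1 : Continuous ur)
    (h2 : Continuous w) (h3 : Continuous lam) (h4 : Continuous P)
    (k0 : ∀ p ∈ S, 2 * μ + lam p ≠ 0) :
    ContinuousOn (fun p => Qx μ β γ (ur p) (w p) (lam p) (P p) * p.1) S := by
  unfold Qx
  have k1 : ∀ p ∈ S, (2 * μ + lam p) ^ 2 ≠ 0 := fun p hp => pow_ne_zero 2 (k0 p hp)
  fun_prop (disch := assumption)

set_option maxHeartbeats 1000000 in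
/-- **Energy-type estimate for the effective viscous flux.** If `‖ρ‖_{L^∞} ≤ C₀`, then
there is a constant `C` depending only on `C₀, μ, β, γ` and `Ω` such that
`(1/2)(d/dt)∫_Ω F²/(2μ+λ) dx + ∫_Ω ρ|u̇|² dx ≤ C + C‖∇u‖₄⁴` for `t ∈ (0,T)`. -/
theorem flux_energy_estimate
    (μ β γ R C₀ : ℝ)
    (hμ : 0 < μ) (hβ : 1 < β) (hγ : 1 < γ) (hR : 0 < R) (hC₀ : 0 < C₀) :
    ∃ C > 0, ∀ T > 0, ∀ ρ u : ℝ → ℝ → ℝ,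
      RadialSolution μ β γ R T ρ u →
      (∀ r ∈ Icc (0:ℝ) R, ∀ t ∈ Icc (0:ℝ) T, ρ r t ≤ C₀) →
      ∀ t ∈ Ioo (0:ℝ) T,
        (1 / 2) * deriv (fun τ => 2 * Real.pi *
              ∫ r in Ioo (0:ℝ) R, (flux μ β γ ρ u r τ) ^ 2 / (2 * μ + ρ r τ ^ β) * r) t
          + 2 * Real.pi * (∫ r in Ioo (0:ℝ) R, ρ r t * (mder u r t) ^ 2 * r)
          ≤ C + C * (2 * Real.pi * ∫ r in Ioo (0:ℝ) R, (gradSq u r t) ^ 2 * r) := by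
  have hrp := Real.rpow_nonneg hC₀.le β
  have hrp' := Real.rpow_nonneg hC₀.le γ
  obtain ⟨C1, hC1⟩ : ∃ C1, C1 = 40 * ((2 * μ + C₀ ^ β + C₀ ^ γ) ^ 2 / (2 * μ) * (1 + β)
        + (2 * μ + C₀ ^ β + C₀ ^ γ) * (C₀ ^ γ / (2 * μ) * (γ + β))
        + (2 * μ + C₀ ^ β + C₀ ^ γ)) := ⟨_, rfl⟩
  have hC1p : 0 < C1 := by rw [hC1]; positivity
  refine ⟨C1 * (1 + Real.pi * R ^ 2), by positivity, ?_⟩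
  intro T hT ρ u hsol hρb t ht
  obtain ⟨ρr, ρt, -, -, cρ, cρr, cρt, -, -, dρr, dρt, -, -, -⟩ := partials ρ hsol.smooth_ρ
  obtain ⟨ur, ut, urr, urt, cu, cur, cut, curr, curt, dur, dut, durr, durt, dutr⟩ :=
    partials u hsol.smooth_u
  obtain ⟨w, cw, hw⟩ := quot_cont u ur cur dur
  obtain ⟨v, cv, hv⟩ := quot_cont ut urt curt dutr
  have ut_bd : ∀ r, (∀ τ ∈ Icc 0 T, u r τ = 0) → ∀ τ ∈ Ioo 0 T, ut r τ = 0 := by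
    intro r hr τ hτ
    have h1 : HasDerivAt (fun τ => u r τ) 0 τ :=
      (hasDerivAt_const τ (0:ℝ)).congr_of_eventuallyEq (by
        filter_upwards [Ioo_mem_nhds hτ.1 hτ.2] with x hx
        exact hr x (Ioo_subset_Icc_self hx))
    exact (dut r τ).unique h1
  have ut0 := ut_bd 0 hsol.bc0
  have utR := ut_bd R hsol.bcR
  have hw' : ∀ r, ∀ τ ∈ Icc 0 T, u r τ = w r τ * r := fun r τ hτ => hw r τ (hsol.bc0 τ hτ)
  have hv' : ∀ r, ∀ τ ∈ Ioo 0 T, ut r τ = v r τ * r := fun r τ hτ => hv r τ (ut0 τ hτ)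
  have dwr : ∀ r, 0 < r → ∀ τ ∈ Icc 0 T,
      HasDerivAt (fun s => w s τ) ((ur r τ - w r τ) / r) r := by
    intro r hr τ hτ
    have h1 := (dur r τ).div (hasDerivAt_id r) hr.ne'
    refine (h1.congr_of_eventuallyEq ?_).congr_deriv ?_
    · filter_upwards [Ioi_mem_nhds hr] with x hx
      have hx : x ≠ 0 := ne_of_gt hx
      simp only [Pi.div_apply, id]
      rw [hw' x τ hτ]; field_simp
    · simp only [id]
      rw [hw' r τ hτ]; field_simp
  have dwt : ∀ r, 0 < r → ∀ τ ∈ Ioo 0 T, HasDerivAt (fun τ => w r τ) (v r τ) τ := by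
    intro r hr τ hτ
    have h1 := (dut r τ).div_const r
    refine (h1.congr_of_eventuallyEq ?_).congr_deriv ?_
    · filter_upwards [Ioo_mem_nhds hτ.1 hτ.2] with x hx
      rw [hw' r x (Ioo_subset_Icc_self hx)]; field_simp
    · rw [hv' r τ hτ]; field_simp
  have hρp := hsol.ρ_pos
  have kpos : ∀ r ∈ Icc 0 R, ∀ τ ∈ Icc 0 T, 0 < 2 * μ + ρ r τ ^ β := by
    intro r hr τ hτ
    have := Real.rpow_pos_of_pos (hρp r hr τ hτ) β
    positivity
  -- continuity of the building blocks
  have clam : Continuous (Function.uncurry fun r τ => ρ r τ ^ β) :=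
    cρ.rpow_const (fun _ => Or.inr (by linarith))
  have cP : Continuous (Function.uncurry fun r τ => ρ r τ ^ γ) :=
    cρ.rpow_const (fun _ => Or.inr (by linarith))
  have clp : Continuous (Function.uncurry fun r τ => β * ρ r τ ^ (β - 1)) :=
    continuous_const.mul (cρ.rpow_const (fun _ => Or.inr (by linarith)))
  have cpp : Continuous (Function.uncurry fun r τ => γ * ρ r τ ^ (γ - 1)) :=
    continuous_const.mul (cρ.rpow_const (fun _ => Or.inr (by linarith)))
  have k0 : ∀ p ∈ Icc 0 R ×ˢ Icc 0 T,
      2 * μ + (Function.uncurry fun r τ => ρ r τ ^ β) p ≠ 0 :=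
    fun p hp => (kpos p.1 hp.1 p.2 hp.2).ne'
  have cG : ContinuousOn (Function.uncurry fun r τ =>
      Gx μ (ur r τ) (w r τ) (ρ r τ ^ β) (ρ r τ ^ γ) * r) (Icc 0 R ×ˢ Icc 0 T) :=
    cont_G _ _ _ _ _ _ cur cw clam cP k0
  have cH : ContinuousOn (Function.uncurry fun r τ =>
      Hx μ (ρt r τ) (ur r τ) (urt r τ) (w r τ) (v r τ) (ρ r τ ^ β) (ρ r τ ^ γ)
        (β * ρ r τ ^ (β - 1)) (γ * ρ r τ ^ (γ - 1)) * r) (Icc 0 R ×ˢ Icc 0 T) :=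
    cont_H _ _ _ _ _ _ _ _ _ _ _ cρt cur curt cw cv clam cP clp cpp k0
  have cQ : ContinuousOn (Function.uncurry fun r τ =>
      Qx μ β γ (ur r τ) (w r τ) (ρ r τ ^ β) (ρ r τ ^ γ) * r) (Icc 0 R ×ˢ Icc 0 T) :=
    cont_Q _ _ _ _ _ _ _ _ cur cw clam cP k0
  have slice : ∀ K : ℝ → ℝ → ℝ, ContinuousOn (Function.uncurry K) (Icc 0 R ×ˢ Icc 0 T) →
      ContinuousOn (fun r => K r t) (Icc 0 R) := by
    intro K hK
    exact hK.comp (f := fun r : ℝ => (r, t)) (by fun_prop)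
        (fun r hr => ⟨hr, Ioo_subset_Icc_self ht⟩)
  have integ : ∀ f : ℝ → ℝ, ContinuousOn f (Icc 0 R) → IntegrableOn f (Ioo 0 R) := fun f hf =>
    (hf.integrableOn_compact isCompact_Icc).mono_set Ioo_subset_Icc_self
  -- time derivative
  have hderiv : HasDerivAt (fun τ => ∫ r in Ioo (0:ℝ) R,
      (flux μ β γ ρ u r τ) ^ 2 / (2 * μ + ρ r τ ^ β) * r)
      (∫ r in Ioo (0:ℝ) R, Hx μ (ρt r t) (ur r t) (urt r t) (w r t) (v r t) (ρ r t ^ β)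
        (ρ r t ^ γ) (β * ρ r t ^ (β - 1)) (γ * ρ r t ^ (γ - 1)) * r) t := by
    refine (deriv_int R T _ _ cG cH ?_ t ht).congr_of_eventuallyEq ?_
    · intro r hr τ hτ
      have hκ := (kpos r (Ioo_subset_Icc_self hr) τ (Ioo_subset_Icc_self hτ)).ne'
      have d1 := ((dρt r τ).rpow_const (p := β) (Or.inr hβ.le)).const_add (2 * μ)
      have d2 := (dρt r τ).rpow_const (p := γ) (Or.inr hγ.le)
      have d3 := (d1.mul ((durt r τ).add (dwt r hr.1 τ hτ))).sub d2
      have d4 := (((d3.pow 2).div d1 hκ).mul_const r)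
      refine d4.congr_deriv ?_
      simp only [Hx, Pi.mul_apply, Pi.add_apply, Pi.sub_apply, Pi.pow_apply]
      field_simp
      ring
    · filter_upwards [Ioo_mem_nhds ht.1 ht.2] with τ hτ
      refine setIntegral_congr_fun measurableSet_Ioo fun r hr => ?_
      have hr0 : r ≠ 0 := hr.1.ne'
      simp only [flux, rdiv, Gx, (dur r τ).deriv, hw' r τ (Ioo_subset_Icc_self hτ)]
      field_simp
  have htc : t ∈ Icc 0 T := Ioo_subset_Icc_self ht
  -- pointwise equation
  have massE : ∀ r ∈ Ioo 0 R,
      ρt r t + ρr r t * (w r t * r) + ρ r t * (ur r t + w r t) = 0 := by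
    intro r hr
    have hr0 : r ≠ 0 := hr.1.ne'
    have h := hsol.mass r hr t htc
    have d5 : HasDerivAt (fun s => ρ s t * u s t) _ r := (dρr r t).mul (dur r t)
    rw [(dρt r t).deriv, d5.deriv, hw' r t htc] at h
    field_simp at h
    linarith
  have dF : ∀ r ∈ Ioo 0 R, HasDerivAt
      (fun s => (2 * μ + ρ s t ^ β) * (ur s t + w s t) - ρ s t ^ γ)
      (β * ρ r t ^ (β - 1) * ρr r t * (ur r t + w r t)
        + (2 * μ + ρ r t ^ β) * (urr r t + (ur r t - w r t) / r)
        - γ * ρ r t ^ (γ - 1) * ρr r t) r := by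
    intro r hr
    have d1 := ((dρr r t).rpow_const (p := β) (Or.inr hβ.le)).const_add (2 * μ)
    have d2 := (dρr r t).rpow_const (p := γ) (Or.inr hγ.le)
    have d3 := (d1.mul ((durr r t).add (dwr r hr.1 t htc))).sub d2
    refine d3.congr_deriv ?_
    simp only [Pi.add_apply]
    ring
  have momE : ∀ r ∈ Ioo 0 R, β * ρ r t ^ (β - 1) * ρr r t * (ur r t + w r t)
        + (2 * μ + ρ r t ^ β) * (urr r t + (ur r t - w r t) / r)
        - γ * ρ r t ^ (γ - 1) * ρr r t = ρ r t * (v r t * r + w r t * r * ur r t) := by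
    intro r hr
    have hr0 : r ≠ 0 := hr.1.ne'
    have h := hsol.momentum r hr t htc
    have d2 := (dρr r t).rpow_const (p := γ) (Or.inr hγ.le)
    have d4 : HasDerivAt (fun s => (2 * μ + ρ s t ^ β) * rdiv u s t) _ r :=
      ((dF r hr).add d2).congr_of_eventuallyEq (by
        filter_upwards [Ioi_mem_nhds hr.1] with x hx
        have hx : x ≠ 0 := ne_of_gt hx
        simp only [rdiv, (dur x t).deriv, hw' x t htc, Pi.add_apply]
        field_simp
        ring)
    have d5 : HasDerivAt (fun s => ρ s t * u s t ^ 2) _ r := (dρr r t).mul ((dur r t).pow 2)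
    have d6 : HasDerivAt (fun τ => ρ r τ * u r τ) _ t := (dρt r t).mul (dut r t)
    rw [d6.deriv,
      d5.deriv, d2.deriv, d4.deriv] at h
    have hm := massE r hr
    simp only [Pi.pow_apply, hw' r t htc, hv' r t ht] at h
    have e : ρ r t * (w r t * r) ^ 2 / r = ρ r t * w r t ^ 2 * r := by field_simp
    rw [e] at h
    push_cast at h
    linear_combination (exp := 1) -h + (w r t * r) * hm
  -- the boundary flux
  obtain ⟨Φ, hΦ⟩ : ∃ Φ : ℝ → ℝ, Φ = fun s =>
    ((2 * μ + ρ s t ^ β) * (ur s t + w s t) - ρ s t ^ γ) * ((ut s t + u s t * ur s t) * s)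
      - (1 / 2) * ((u s t * s) *
        (((2 * μ + ρ s t ^ β) * (ur s t + w s t) - ρ s t ^ γ) ^ 2 / (2 * μ + ρ s t ^ β))) :=
    ⟨_, rfl⟩
  have sl : ∀ K : ℝ → ℝ → ℝ, Continuous (Function.uncurry K) → Continuous (fun r => K r t) :=
    fun K hK => hK.comp (f := fun r : ℝ => (r, t)) (by fun_prop)
  have sρ := sl _ cρ
  have su := sl _ cu
  have sur := sl _ cur
  have sut := sl _ cut
  have sw := sl _ cw
  have slam := sl _ clam
  have sP := sl _ cP
  have cΦ : ContinuousOn Φ (Icc 0 R) := by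
    rw [hΦ]
    have sF : Continuous fun s => (2 * μ + ρ s t ^ β) * (ur s t + w s t) - ρ s t ^ γ :=
      ((continuous_const.add slam).mul (sur.add sw)).sub sP
    refine (sF.mul ((sut.add (su.mul sur)).mul continuous_id)).continuousOn.sub
      (continuousOn_const.mul ((su.mul continuous_id).continuousOn.mul
        ((sF.pow 2).continuousOn.div (continuous_const.add slam).continuousOn ?_)))
    intro s hs
    exact (kpos s hs t htc).ne'
  obtain ⟨Ψ, hΨ⟩ : ∃ Ψ : ℝ → ℝ, Ψ = fun r => (1 / 2) * (Hx μ (ρt r t) (ur r t) (urt r t) (w r t)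
        (v r t) (ρ r t ^ β)
        (ρ r t ^ γ) (β * ρ r t ^ (β - 1)) (γ * ρ r t ^ (γ - 1)) * r)
        + ρ r t * (ut r t + u r t * ur r t) ^ 2 * r
        - Qx μ β γ (ur r t) (w r t) (ρ r t ^ β) (ρ r t ^ γ) * r := ⟨_, rfl⟩
  have cX : ContinuousOn (fun r => ρ r t * (ut r t + u r t * ur r t) ^ 2 * r) (Icc 0 R) :=
    ((sρ.mul ((sut.add (su.mul sur)).pow 2)).mul continuous_id).continuousOn
  have cHs := slice _ cH
  have cQs := slice _ cQ
  have cΨ : ContinuousOn Ψ (Icc 0 R) := by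
    rw [hΨ]
    exact ((continuousOn_const.mul cHs).add cX).sub cQs
  have dΦ : ∀ r ∈ Ioo 0 R, HasDerivAt Φ (Ψ r) r := by
    intro r hr
    have hr0 : r ≠ 0 := hr.1.ne'
    have hrc := Ioo_subset_Icc_self hr
    have hκ := (kpos r hrc t htc).ne'
    have hρ0 := hρp r hrc t htc
    have dF' := dF r hr
    rw [momE r hr] at dF'
    have d1 := ((dρr r t).rpow_const (p := β) (Or.inr hβ.le)).const_add (2 * μ)
    have d6 := dF'.mul (((dutr r t).add ((dur r t).mul (durr r t))).mul (hasDerivAt_id r))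
    have d7 := (((dur r t).mul (hasDerivAt_id r)).mul ((dF'.pow 2).div d1 hκ)).const_mul (1 / 2 : ℝ)
    have d8 := d6.sub d7
    have e3 : ρ r t * (β * ρ r t ^ (β - 1)) = β * ρ r t ^ β := by
      rw [Real.rpow_sub_one hρ0.ne']; field_simp
    have e4 : ρ r t * (γ * ρ r t ^ (γ - 1)) = γ * ρ r t ^ γ := by
      rw [Real.rpow_sub_one hρ0.ne']; field_simp
    have key := alg_id μ β γ r (ρ r t) (ρt r t) (ρr r t) (ur r t) (urr r t) (urt r t) (w r t)
      (v r t) (ρ r t ^ β) (ρ r t ^ γ) (β * ρ r t ^ (β - 1)) (γ * ρ r t ^ (γ - 1)) hr0 hκ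
      (massE r hr) (momE r hr) e3 e4
    rw [hΦ]
    refine d8.congr_deriv ?_
    rw [hΨ]
    simp only [Hx, Qx, Pi.mul_apply, Pi.add_apply, Pi.sub_apply, Pi.pow_apply, Pi.div_apply, id,
      hw' r t htc, hv' r t ht]
    rw [key]
    field_simp
    ring
  have hΨ0 : ∫ r in Ioo 0 R, Ψ r = 0 := by
    have h := intervalIntegral.integral_eq_sub_of_hasDerivAt_of_le hR.le cΦ dΦ
      (cΨ.intervalIntegrable_of_Icc hR.le)
    rw [intervalIntegral.integral_of_le hR.le, integral_Ioc_eq_integral_Ioo] at h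
    rw [h, hΦ]
    simp [hsol.bc0 t htc, hsol.bcR t htc, utR t ht]
  -- conclusion
  have iH := integ _ cHs
  have iX := integ _ cX
  have iQ := integ _ cQs
  have hsplit : (1 / 2) * (∫ r in Ioo (0:ℝ) R, Hx μ (ρt r t) (ur r t) (urt r t) (w r t) (v r t)
        (ρ r t ^ β) (ρ r t ^ γ) (β * ρ r t ^ (β - 1)) (γ * ρ r t ^ (γ - 1)) * r)
      + (∫ r in Ioo 0 R, ρ r t * (ut r t + u r t * ur r t) ^ 2 * r)
      = ∫ r in Ioo 0 R, Qx μ β γ (ur r t) (w r t) (ρ r t ^ β) (ρ r t ^ γ) * r := by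
    rw [hΨ] at hΨ0
    have h := int_split _ _ _ _ iH iX iQ
    exact sub_eq_zero.mp (h.symm.trans hΨ0)
  have cg : ContinuousOn (fun r => (ur r t ^ 2 + w r t ^ 2) ^ 2 * r) (Icc 0 R) :=
    ((((sur.pow 2).add (sw.pow 2)).pow 2).mul continuous_id).continuousOn
  have ig := integ _ cg
  have ir : IntegrableOn (fun r : ℝ => r) (Ioo 0 R) := integ _ continuous_id.continuousOn
  have hrint : ∫ r in Ioo (0:ℝ) R, r = R ^ 2 / 2 := by
    rw [← integral_Ioc_eq_integral_Ioo, ← intervalIntegral.integral_of_le hR.le, integral_id]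
    ring
  have hQle : ∫ r in Ioo 0 R, Qx μ β γ (ur r t) (w r t) (ρ r t ^ β) (ρ r t ^ γ) * r
      ≤ C1 * (R ^ 2 / 2) + C1 * ∫ r in Ioo 0 R, (ur r t ^ 2 + w r t ^ 2) ^ 2 * r := by
    rw [← hrint, ← integral_const_mul, ← integral_const_mul,
      ← integral_add (ir.const_mul C1) (ig.const_mul C1)]
    refine setIntegral_mono_on iQ ((ir.const_mul C1).add (ig.const_mul C1)) measurableSet_Ioo ?_
    intro r hr
    have hrc := Ioo_subset_Icc_self hr
    have hρ0 := (hρp r hrc t htc).le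
    have hb := bound_Q μ β γ (C₀ ^ β) (C₀ ^ γ) (ur r t) (w r t) (ρ r t ^ β) (ρ r t ^ γ) hμ hβ hγ
      (Real.rpow_nonneg hρ0 _) (Real.rpow_le_rpow hρ0 (hρb r hrc t htc) (by linarith))
      (Real.rpow_nonneg hρ0 _) (Real.rpow_le_rpow hρ0 (hρb r hrc t htc) (by linarith))
    rw [← hC1] at hb
    have := mul_le_mul_of_nonneg_right hb hr.1.le
    simp only [Qx]
    linarith
  have eg : ∫ r in Ioo (0:ℝ) R, (gradSq u r t) ^ 2 * r
      = ∫ r in Ioo 0 R, (ur r t ^ 2 + w r t ^ 2) ^ 2 * r := by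
    refine setIntegral_congr_fun measurableSet_Ioo fun r hr => ?_
    have hr0 : r ≠ 0 := hr.1.ne'
    have : u r t / r = w r t := by rw [hw' r t htc]; field_simp
    simp only [gradSq, (dur r t).deriv, this]
  have eX : ∫ r in Ioo (0:ℝ) R, ρ r t * (mder u r t) ^ 2 * r
      = ∫ r in Ioo 0 R, ρ r t * (ut r t + u r t * ur r t) ^ 2 * r := by
    simp only [mder, (dur _ t).deriv, (dut _ t).deriv]
  have hg0 : 0 ≤ ∫ r in Ioo 0 R, (ur r t ^ 2 + w r t ^ 2) ^ 2 * r :=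
    setIntegral_nonneg measurableSet_Ioo fun r hr => mul_nonneg (sq_nonneg _) hr.1.le
  rw [(hderiv.const_mul (2 * Real.pi)).deriv, eg, eX]
  have hpi := Real.pi_pos
  have h1 := mul_le_mul_of_nonneg_left (hsplit.trans_le hQle) (by positivity : 0 ≤ 2 * Real.pi)
  have h2 : 0 ≤ C1 * (Real.pi * R ^ 2) *
      (2 * Real.pi * ∫ r in Ioo 0 R, (ur r t ^ 2 + w r t ^ 2) ^ 2 * r) := by positivity
  linarith
end
end

section
/- Let (ρ, u) be a radially symmetric strong solution on [0,R] × [0,T] with ‖ρ‖_{L^∞(Ω×(0,T))} ≤ C₀, let λ = ρ^β, and let u̇ = u_t + u u_r denote the material derivative (for the 2D field, u̇ = u_t + (u·∇)u). Then there is a constant C depending only on C₀, μ, β, γ and Ω such that for all t ∈ (0,T), (1/2)(d/dt) ‖√ρ u̇‖_{L²(Ω)}² + μ ‖div u̇‖_{L²(Ω)}² + (1/2) ∫_Ω λ |D(div u)/Dt|² dx ≤ C ‖∇u‖_{L⁴(Ω)}⁴ + C, where D(div u)/Dt = (div u)_t + u ∂_r(div u). -/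
open MeasureTheory Set Filter

noncomputable section

open scoped ContDiff Topology

/-- Partial derivative in the first variable. -/
def pd1 (f : ℝ → ℝ → ℝ) (r t : ℝ) : ℝ := deriv (fun s => f s t) r

/-- Partial derivative in the second variable. -/
def pd2 (f : ℝ → ℝ → ℝ) (r t : ℝ) : ℝ := deriv (fun τ => f r τ) t

/-- Joint smoothness. -/
def Smo (f : ℝ → ℝ → ℝ) : Prop := ContDiff ℝ ∞ (fun p : ℝ × ℝ => f p.1 p.2)

lemma hasDerivAt_pd1_fd {f : ℝ × ℝ → ℝ} {r t : ℝ} (h : DifferentiableAt ℝ f (r, t)) :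
    HasDerivAt (fun s => f (s, t)) (fderiv ℝ f (r, t) (1, 0)) r :=
  h.hasFDerivAt.comp_hasDerivAt r ((hasDerivAt_id r).prodMk (hasDerivAt_const r t))

lemma hasDerivAt_pd2_fd {f : ℝ × ℝ → ℝ} {r t : ℝ} (h : DifferentiableAt ℝ f (r, t)) :
    HasDerivAt (fun s => f (r, s)) (fderiv ℝ f (r, t) (0, 1)) t :=
  h.hasFDerivAt.comp_hasDerivAt t ((hasDerivAt_const t r).prodMk (hasDerivAt_id t))

lemma hasDerivAt_pd1 {f : ℝ → ℝ → ℝ} {r t : ℝ}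
    (h : DifferentiableAt ℝ (fun p : ℝ × ℝ => f p.1 p.2) (r, t)) :
    HasDerivAt (fun s => f s t) (pd1 f r t) r :=
  (hasDerivAt_pd1_fd h).differentiableAt.hasDerivAt

lemma hasDerivAt_pd2 {f : ℝ → ℝ → ℝ} {r t : ℝ}
    (h : DifferentiableAt ℝ (fun p : ℝ × ℝ => f p.1 p.2) (r, t)) :
    HasDerivAt (fun s => f r s) (pd2 f r t) t :=
  (hasDerivAt_pd2_fd h).differentiableAt.hasDerivAt

lemma pd1_eq_fd {f : ℝ → ℝ → ℝ} {r t : ℝ}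
    (h : DifferentiableAt ℝ (fun p : ℝ × ℝ => f p.1 p.2) (r, t)) :
    pd1 f r t = fderiv ℝ (fun p : ℝ × ℝ => f p.1 p.2) (r, t) (1, 0) :=
  (hasDerivAt_pd1_fd h).deriv

lemma pd2_eq_fd {f : ℝ → ℝ → ℝ} {r t : ℝ}
    (h : DifferentiableAt ℝ (fun p : ℝ × ℝ => f p.1 p.2) (r, t)) :
    pd2 f r t = fderiv ℝ (fun p : ℝ × ℝ => f p.1 p.2) (r, t) (0, 1) :=
  (hasDerivAt_pd2_fd h).deriv

lemma mixed {f : ℝ → ℝ → ℝ} {r t : ℝ}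
    (h : ContDiffAt ℝ 2 (fun p : ℝ × ℝ => f p.1 p.2) (r, t)) :
    HasDerivAt (fun s => pd2 f s t) (pd2 (pd1 f) r t) r := by
  set g : ℝ × ℝ → ℝ := fun p : ℝ × ℝ => f p.1 p.2 with hg
  have hev : ∀ᶠ p in 𝓝 (r, t), DifferentiableAt ℝ g p := by
    filter_upwards [h.eventually (by simp)] with p hp
    exact hp.differentiableAt (by simp)
  have hd : DifferentiableAt ℝ (fderiv ℝ g) (r, t) :=
    (h.fderiv_right (m := 1) (by norm_num)).differentiableAt (by simp)
  have hsym : fderiv ℝ (fderiv ℝ g) (r, t) (1, 0) (0, 1)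
      = fderiv ℝ (fderiv ℝ g) (r, t) (0, 1) (1, 0) :=
    (h.isSymmSndFDerivAt (by simp)) _ _
  have e1 : ∀ᶠ s in 𝓝 r, pd2 f s t = fderiv ℝ g (s, t) (0, 1) := by
    have : Tendsto (fun s : ℝ => (s, t)) (𝓝 r) (𝓝 (r, t)) :=
      (by fun_prop : Continuous (fun s : ℝ => (s, t))).tendsto r
    filter_upwards [this.eventually hev] with s hs
    exact pd2_eq_fd hs
  have e2 : ∀ᶠ s in 𝓝 t, pd1 f r s = fderiv ℝ g (r, s) (1, 0) := by
    have : Tendsto (fun s : ℝ => (r, s)) (𝓝 t) (𝓝 (r, t)) :=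
      (by fun_prop : Continuous (fun s : ℝ => (r, s))).tendsto t
    filter_upwards [this.eventually hev] with s hs
    exact pd1_eq_fd hs
  have d1 : HasDerivAt (fun s => fderiv ℝ g (s, t) (0, 1))
      (fderiv ℝ (fderiv ℝ g) (r, t) (1, 0) (0, 1)) r := by
    have := hd.hasFDerivAt.comp_hasDerivAt r ((hasDerivAt_id r).prodMk (hasDerivAt_const r t))
    simpa using this.clm_apply (hasDerivAt_const r ((0, 1) : ℝ × ℝ))
  have d2 : HasDerivAt (fun s => fderiv ℝ g (r, s) (1, 0))
      (fderiv ℝ (fderiv ℝ g) (r, t) (0, 1) (1, 0)) t := by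
    have := hd.hasFDerivAt.comp_hasDerivAt t ((hasDerivAt_const t r).prodMk (hasDerivAt_id t))
    simpa using this.clm_apply (hasDerivAt_const t ((1, 0) : ℝ × ℝ))
  have e3 : pd2 (pd1 f) r t = fderiv ℝ (fderiv ℝ g) (r, t) (0, 1) (1, 0) :=
    (d2.congr_of_eventuallyEq e2).deriv
  rw [e3, ← hsym]
  exact d1.congr_of_eventuallyEq e1

lemma Smo.diff {f : ℝ → ℝ → ℝ} (h : Smo f) :
    Differentiable ℝ (fun p : ℝ × ℝ => f p.1 p.2) := ContDiff.differentiable h (by simp)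

lemma Smo.pd1 {f : ℝ → ℝ → ℝ} (h : Smo f) : Smo (pd1 f) := by
  have : (fun p : ℝ × ℝ => _root_.pd1 f p.1 p.2)
      = fun p : ℝ × ℝ => fderiv ℝ (fun p : ℝ × ℝ => f p.1 p.2) p (1, 0) := by
    ext p
    exact pd1_eq_fd (h.diff (p.1, p.2))
  unfold Smo
  rw [this]
  exact (ContDiff.fderiv_right (m := ∞) h (by simp)).clm_apply contDiff_const

lemma Smo.pd2 {f : ℝ → ℝ → ℝ} (h : Smo f) : Smo (pd2 f) := by
  have : (fun p : ℝ × ℝ => _root_.pd2 f p.1 p.2)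
      = fun p : ℝ × ℝ => fderiv ℝ (fun p : ℝ × ℝ => f p.1 p.2) p (0, 1) := by
    ext p
    exact pd2_eq_fd (h.diff (p.1, p.2))
  unfold Smo
  rw [this]
  exact (ContDiff.fderiv_right (m := ∞) h (by simp)).clm_apply contDiff_const

lemma Smo.cont {f : ℝ → ℝ → ℝ} (h : Smo f) : Continuous (fun p : ℝ × ℝ => f p.1 p.2) :=
  ContDiff.continuous h

lemma Smo.cont1 {f : ℝ → ℝ → ℝ} (h : Smo f) (t : ℝ) : Continuous (fun r => f r t) :=
  h.cont.comp (by fun_prop : Continuous (fun s : ℝ => (s, t)))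

lemma Smo.h1 {f : ℝ → ℝ → ℝ} (h : Smo f) (r t : ℝ) :
    HasDerivAt (fun s => f s t) (_root_.pd1 f r t) r := hasDerivAt_pd1 (h.diff _)

lemma Smo.h2 {f : ℝ → ℝ → ℝ} (h : Smo f) (r t : ℝ) :
    HasDerivAt (fun s => f r s) (_root_.pd2 f r t) t := hasDerivAt_pd2 (h.diff _)

lemma Smo.comm {f : ℝ → ℝ → ℝ} (h : Smo f) (r t : ℝ) :
    _root_.pd1 (_root_.pd2 f) r t = _root_.pd2 (_root_.pd1 f) r t :=
  (mixed (by exact_mod_cast (contDiff_infty.1 h 2).contDiffAt)).deriv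

lemma mder_eq (u : ℝ → ℝ → ℝ) : mder u = fun r t => pd2 u r t + u r t * pd1 u r t := rfl

lemma Smo.mder {u : ℝ → ℝ → ℝ} (h : Smo u) : Smo (mder u) := by
  have h1 := h.pd1
  have h2 := h.pd2
  unfold Smo at *
  exact h2.add (h.mul h1)

/-- Differentiation under the integral sign. -/
lemma deriv_int_s14 {g : ℝ → ℝ → ℝ} (h : Smo g) (R t : ℝ) :
    HasDerivAt (fun τ => ∫ r in Ioo (0:ℝ) R, g r τ) (∫ r in Ioo (0:ℝ) R, pd2 g r t) t := by
  obtain ⟨K, hK⟩ := ((isCompact_Icc (a := (0:ℝ)) (b := R)).prod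
    (isCompact_Icc (a := t - 1) (b := t + 1))).exists_bound_of_continuousOn h.pd2.cont.continuousOn
  have hcint : ∀ f : ℝ → ℝ, Continuous f → IntegrableOn f (Ioo 0 R) := fun f hf =>
    (hf.continuousOn.integrableOn_Icc (a := 0) (b := R)).mono_set Ioo_subset_Icc_self
  refine (hasDerivAt_integral_of_dominated_loc_of_deriv_le (F := fun τ r => g r τ)
    (F' := fun τ r => pd2 g r τ) (bound := fun _ => K) (s := Icc (t - 1) (t + 1))
    (Icc_mem_nhds (by linarith) (by linarith)) ?_ ?_ ?_ ?_ ?_ ?_).2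
  · exact Eventually.of_forall fun τ => (h.cont1 τ).aestronglyMeasurable
  · exact hcint _ (h.cont1 t)
  · exact (h.pd2.cont1 t).aestronglyMeasurable
  · filter_upwards [ae_restrict_mem measurableSet_Ioo] with r hr τ hτ
    exact hK (r, τ) ⟨Ioo_subset_Icc_self hr, hτ⟩
  · exact hcint _ continuous_const
  · exact Eventually.of_forall fun r τ _ => h.h2 r τ

/-- Continuous extension of `f r / r` at `r = 0`. -/
def qt (f : ℝ → ℝ → ℝ) (t r : ℝ) : ℝ := dslope (fun s => f s t) 0 r

lemma qt_eq {f : ℝ → ℝ → ℝ} {t r : ℝ} (h0 : f 0 t = 0) (hr : r ≠ 0) : qt f t r = f r t / r := by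
  unfold qt
  rw [dslope_of_ne _ hr, slope_def_field, h0]
  simp

lemma qt_cont {f : ℝ → ℝ → ℝ} (h : Smo f) (t : ℝ) : Continuous (qt f t) := by
  have := (continuousOn_dslope (f := fun s => f s t) (a := 0) (s := univ) univ_mem).2
    ⟨(h.cont1 t).continuousOn, (h.h1 0 t).differentiableAt⟩
  exact continuousOn_univ.1 this

/-- The constant in the pointwise inequality. -/
def cst (μ β γ lam pp : ℝ) : ℝ :=
  lam / 2 + (2 * μ + 2 * β * lam + 2 * γ * pp) ^ 2 / μ
    + (2 * (2 * (2 * μ + lam) ^ 2 + pp ^ 2)) / μ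

set_option maxHeartbeats 2000000 in
/-- The pointwise algebraic inequality. -/
lemma pointwise_alg {μ β γ lam pp l p x y a b : ℝ} (hμ : 0 < μ) (hβ : 0 < β) (hγ : 0 < γ)
    (hl0 : 0 ≤ l) (hl : l ≤ lam) (hp0 : 0 ≤ p) (hp : p ≤ pp) :
    μ * (x + y) ^ 2 + 1 / 2 * (l * ((x + y) - (a ^ 2 + b ^ 2)) ^ 2) ≤
      (x + y) * ((2 * μ + l) * ((x + y) - (a ^ 2 + b ^ 2)) - β * l * (a + b) ^ 2
        + γ * p * (a + b))
      + (x * b + y * a) * ((2 * μ + l) * (a + b) - p) - μ * y * x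
      + cst μ β γ lam pp * ((a ^ 2 + b ^ 2) ^ 2 + 1) := by
  set G := a ^ 2 + b ^ 2 with hG
  clear_value G
  set A := x + y with hA
  clear_value A
  set d := a + b with hd
  clear_value d
  have hG0 : 0 ≤ G := by rw [hG]; positivity
  have hd2 : d ^ 2 ≤ 2 * G := by rw [hd, hG]; nlinarith [sq_nonneg (a - b)]
  have hlam : 0 ≤ lam := hl0.trans hl
  have hpp : 0 ≤ pp := hp0.trans hp
  set E := A - G with hE
  clear_value E
  have h1 : -(lam / 2) * (G ^ 2 + 1) ≤ 1 / 2 * (l * E ^ 2) + l * E * G := by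
    have : 0 ≤ l * (E + G) ^ 2 := by positivity
    nlinarith [mul_nonneg (sub_nonneg.2 hl) (sq_nonneg G)]
  set K := -2 * μ * G - β * l * d ^ 2 + γ * p * d with hK
  clear_value K
  set k := 2 * μ + 2 * β * lam + 2 * γ * pp with hk
  clear_value k
  have hk0 : 0 ≤ k := by rw [hk]; positivity
  have hdabs : |d| ≤ 1 + 2 * G := by
    have i1 := sq_nonneg (d - 1)
    have i2 := sq_nonneg (d + 1)
    rw [abs_le]; constructor <;> linarith
  have hKabs : |K| ≤ k * (G + 1) := by
    have e1 : |K| ≤ 2 * μ * G + β * l * d ^ 2 + γ * p * |d| := by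
      rw [hK]
      refine (abs_add_le _ _).trans (add_le_add ((abs_sub _ _).trans ?_) ?_)
      · rw [abs_of_nonpos (by nlinarith [mul_nonneg hμ.le hG0]),
          abs_of_nonneg (by positivity)]
        linarith
      · rw [abs_mul, abs_of_nonneg (a := γ * p) (by positivity)]
    have e2 : β * l * d ^ 2 ≤ β * lam * (2 * G) := by gcongr
    have e3 : γ * p * |d| ≤ γ * pp * (1 + 2 * G) := by gcongr
    have e4 : 0 ≤ β * lam := by positivity
    have e5 : 0 ≤ γ * pp := by positivity
    rw [hk]
    linarith
  have hK2 : K ^ 2 ≤ 2 * k ^ 2 * (G ^ 2 + 1) := by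
    have : K ^ 2 ≤ (k * (G + 1)) ^ 2 := sq_le_sq' (abs_le.1 hKabs).1 (abs_le.1 hKabs).2
    have i1 := mul_nonneg (sq_nonneg k) (sq_nonneg (G - 1))
    linarith
  have h2 : -(k ^ 2 / μ) * (G ^ 2 + 1) ≤ 1 / 2 * μ * A ^ 2 + A * K := by
    have e : 0 ≤ (μ * A + K) ^ 2 / (2 * μ) := by positivity
    have e' : (μ * A + K) ^ 2 / (2 * μ) = 1 / 2 * μ * A ^ 2 + A * K + K ^ 2 / (2 * μ) := by
      field_simp
      ring
    have e'' : K ^ 2 / (2 * μ) ≤ k ^ 2 / μ * (G ^ 2 + 1) := by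
      rw [div_le_iff₀ (by positivity)]
      have : k ^ 2 / μ * (G ^ 2 + 1) * (2 * μ) = 2 * k ^ 2 * (G ^ 2 + 1) := by field_simp
      rw [this]; exact hK2
    linarith
  set F := (2 * μ + l) * d - p with hF
  clear_value F
  set f := 2 * (2 * (2 * μ + lam) ^ 2 + pp ^ 2) with hf
  clear_value f
  have hF2 : F ^ 2 ≤ f * (G + 1) := by
    have e1 : F ^ 2 ≤ 2 * ((2 * μ + l) ^ 2 * d ^ 2 + p ^ 2) := by
      have i1 := sq_nonneg ((2 * μ + l) * d + p)
      rw [hF]; linarith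
    have e2 : (2 * μ + l) ^ 2 * d ^ 2 ≤ (2 * μ + lam) ^ 2 * (2 * G) := by gcongr
    have e3 : p ^ 2 ≤ pp ^ 2 := by gcongr
    rw [hf]
    have i1 := sq_nonneg (2 * μ + lam)
    have i2 := mul_nonneg (sq_nonneg pp) hG0
    linarith
  have hf0 : 0 ≤ f := by rw [hf]; positivity
  have hGF : G * F ^ 2 ≤ 2 * f * (G ^ 2 + 1) := by
    have : G * F ^ 2 ≤ G * (f * (G + 1)) := by gcongr
    have i1 := mul_nonneg hf0 (sq_nonneg (G - 1))
    have i2 := mul_nonneg hf0 (sq_nonneg G)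
    linarith
  have h3 : -(f / μ) * (G ^ 2 + 1) ≤ 1 / 2 * μ * (x ^ 2 + y ^ 2) + (x * b + y * a) * F := by
    have e : 0 ≤ ((μ * x + b * F) ^ 2 + (μ * y + a * F) ^ 2) / (2 * μ) := by positivity
    have e' : ((μ * x + b * F) ^ 2 + (μ * y + a * F) ^ 2) / (2 * μ)
        = 1 / 2 * μ * (x ^ 2 + y ^ 2) + (x * b + y * a) * F + G * F ^ 2 / (2 * μ) := by
      rw [hG]
      field_simp
      ring
    have e'' : G * F ^ 2 / (2 * μ) ≤ f / μ * (G ^ 2 + 1) := by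
      rw [div_le_iff₀ (by positivity)]
      have : f / μ * (G ^ 2 + 1) * (2 * μ) = 2 * f * (G ^ 2 + 1) := by field_simp
      rw [this]; exact hGF
    linarith
  have hc : cst μ β γ lam pp = lam / 2 + k ^ 2 / μ + f / μ := by
    rw [hk, hf]; rfl
  rw [hc]
  have hid : A * ((2 * μ + l) * E - β * l * d ^ 2 + γ * p * d) + (x * b + y * a) * F - μ * y * x
      - (μ * A ^ 2 + 1 / 2 * (l * E ^ 2))
      = (1 / 2 * (l * E ^ 2) + l * E * G) + (1 / 2 * μ * A ^ 2 + A * K)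
        + (1 / 2 * μ * (x ^ 2 + y ^ 2) + (x * b + y * a) * F) := by
    rw [hK, hE, hA]
    ring
  linarith

lemma cst_pos {μ β γ lam pp : ℝ} (hμ : 0 < μ) (hβ : 0 < β) (hγ : 0 < γ)
    (hl : 0 ≤ lam) (hp : 0 ≤ pp) : 0 < cst μ β γ lam pp := by
  unfold cst
  positivity

lemma rdiv_h1 {u : ℝ → ℝ → ℝ} (hu : Smo u) {r : ℝ} (hr : r ≠ 0) (t : ℝ) :
    HasDerivAt (fun s => rdiv u s t)
      (pd1 (pd1 u) r t + (pd1 u r t * r - u r t * 1) / r ^ 2) r :=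
  (hu.pd1.h1 r t).add ((hu.h1 r t).div (hasDerivAt_id r) hr)

lemma rdiv_h2 {u : ℝ → ℝ → ℝ} (hu : Smo u) (r t : ℝ) :
    HasDerivAt (fun s => rdiv u r s) (pd2 (pd1 u) r t + pd2 u r t / r) t :=
  (hu.pd1.h2 r t).add ((hu.h2 r t).div_const r)

lemma rdiv_mder {u : ℝ → ℝ → ℝ} (hu : Smo u) {r : ℝ} (hr : r ≠ 0) (t : ℝ) :
    deriv (fun τ => rdiv u r τ) t + u r t * deriv (fun s => rdiv u s t) r
      = rdiv (mder u) r t - gradSq u r t := by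
  rw [(rdiv_h1 hu hr t).deriv, (rdiv_h2 hu r t).deriv]
  have h : HasDerivAt (fun s => mder u s t)
      (pd1 (pd2 u) r t + (pd1 u r t * pd1 u r t + u r t * pd1 (pd1 u) r t)) r :=
    (hu.pd2.h1 r t).add ((hu.h1 r t).mul (hu.pd1.h1 r t))
  have e : rdiv (mder u) r t = deriv (fun s => mder u s t) r + mder u r t / r := rfl
  have e2 : gradSq u r t = (pd1 u r t) ^ 2 + (u r t / r) ^ 2 := rfl
  rw [e, h.deriv, e2, mder_eq, hu.comm]
  field_simp
  ring

lemma flux_cd {μ β γ : ℝ} {ρ u : ℝ → ℝ → ℝ} (hρ : Smo ρ) (hu : Smo u) {r t : ℝ}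
    (hr : r ≠ 0) (hpos : 0 < ρ r t) :
    ContDiffAt ℝ 2 (fun p : ℝ × ℝ => flux μ β γ ρ u p.1 p.2) (r, t) := by
  have c : ∀ {f : ℝ → ℝ → ℝ}, Smo f → ContDiffAt ℝ 2 (fun p : ℝ × ℝ => f p.1 p.2) (r, t) :=
    fun {f} h => by exact_mod_cast (contDiff_infty.1 h 2).contDiffAt
  have hp : ∀ q : ℝ, ContDiffAt ℝ 2 (fun p : ℝ × ℝ => ρ p.1 p.2 ^ q) (r, t) := fun q =>
    (c hρ).rpow_const_of_ne hpos.ne'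
  exact ((contDiffAt_const.add (hp β)).mul
    ((c hu.pd1).add ((c hu).div contDiffAt_fst hr))).sub (hp γ)

lemma flux_h1 {μ β γ : ℝ} {ρ u : ℝ → ℝ → ℝ} (hρ : Smo ρ) (hu : Smo u) {r t : ℝ}
    (hr : r ≠ 0) (hpos : 0 < ρ r t) :
    HasDerivAt (fun s => flux μ β γ ρ u s t)
      (pd1 ρ r t * β * ρ r t ^ (β - 1) * rdiv u r t
        + (2 * μ + ρ r t ^ β) * deriv (fun s => rdiv u s t) r
        - pd1 ρ r t * γ * ρ r t ^ (γ - 1)) r := by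
  have hp : ∀ q : ℝ, HasDerivAt (fun s => ρ s t ^ q) (pd1 ρ r t * q * ρ r t ^ (q - 1)) r :=
    fun q => (hρ.h1 r t).rpow_const (Or.inl hpos.ne')
  exact (((hp β).const_add (2 * μ)).mul
    (rdiv_h1 hu hr t).differentiableAt.hasDerivAt).sub (hp γ)

lemma flux_h2 {μ β γ : ℝ} {ρ u : ℝ → ℝ → ℝ} (hρ : Smo ρ) (hu : Smo u) {r t : ℝ}
    (hpos : 0 < ρ r t) :
    HasDerivAt (fun s => flux μ β γ ρ u r s)
      (pd2 ρ r t * β * ρ r t ^ (β - 1) * rdiv u r t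
        + (2 * μ + ρ r t ^ β) * deriv (fun s => rdiv u r s) t
        - pd2 ρ r t * γ * ρ r t ^ (γ - 1)) t := by
  have hp : ∀ q : ℝ, HasDerivAt (fun s => ρ r s ^ q) (pd2 ρ r t * q * ρ r t ^ (q - 1)) t :=
    fun q => (hρ.h2 r t).rpow_const (Or.inl hpos.ne')
  exact (((hp β).const_add (2 * μ)).mul
    (rdiv_h2 hu r t).differentiableAt.hasDerivAt).sub (hp γ)

section sol
variable {μ β γ R T : ℝ} {ρ u : ℝ → ℝ → ℝ}

lemma RadialSolution.sρ (h : RadialSolution μ β γ R T ρ u) : Smo ρ :=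
  contDiff_infty.2 fun n => h.smooth_ρ n

lemma RadialSolution.su (h : RadialSolution μ β γ R T ρ u) : Smo u :=
  contDiff_infty.2 fun n => h.smooth_u n

lemma RadialSolution.mass' (h : RadialSolution μ β γ R T ρ u) {r t : ℝ} (hr : r ∈ Ioo 0 R)
    (ht : t ∈ Icc 0 T) :
    pd2 ρ r t + u r t * pd1 ρ r t + ρ r t * rdiv u r t = 0 := by
  have := h.mass r hr t ht
  rw [((h.sρ.h1 r t).fun_mul (h.su.h1 r t)).deriv] at this
  have e : rdiv u r t = pd1 u r t + u r t / r := rfl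
  have e2 : deriv (fun τ => ρ r τ) t = pd2 ρ r t := rfl
  rw [e2] at this
  rw [e, ← this]
  ring

lemma RadialSolution.mom' (h : RadialSolution μ β γ R T ρ u) {r t : ℝ} (hr : r ∈ Ioo 0 R)
    (ht : t ∈ Icc 0 T) :
    pd1 (flux μ β γ ρ u) r t = ρ r t * mder u r t := by
  have hm := h.mass' hr ht
  have hr0 : r ≠ 0 := hr.1.ne'
  have hpos := h.ρ_pos r (Ioo_subset_Icc_self hr) t ht
  have := h.momentum r hr t ht
  rw [((h.sρ.h2 r t).fun_mul (h.su.h2 r t)).deriv,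
    ((h.sρ.h1 r t).fun_mul ((h.su.h1 r t).fun_pow 2)).deriv] at this
  have hp : ∀ q : ℝ, HasDerivAt (fun s => ρ s t ^ q) (pd1 ρ r t * q * ρ r t ^ (q - 1)) r :=
    fun q => (h.sρ.h1 r t).rpow_const (Or.inl hpos.ne')
  have hd := ((hp β).const_add (2 * μ)).fun_mul (rdiv_h1 h.su hr0 t)
  have e : pd1 (flux μ β γ ρ u) r t
      = deriv (fun s => (2 * μ + ρ s t ^ β) * rdiv u s t) r - deriv (fun s => ρ s t ^ γ) r :=
    (hd.differentiableAt.hasDerivAt.sub (hp γ).differentiableAt.hasDerivAt).deriv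
  rw [e, ← this, mder_eq]
  have e : rdiv u r t = pd1 u r t + u r t / r := rfl
  rw [e] at hm
  have hm2 : (pd2 ρ r t + u r t * pd1 ρ r t + ρ r t * (pd1 u r t + u r t / r)) * u r t = 0 := by
    rw [hm, zero_mul]
  push_cast
  norm_num
  have e3 : ρ r t * u r t ^ 2 / r = ρ r t * (u r t / r) * u r t := by ring
  rw [e3]
  linear_combination hm2

lemma RadialSolution.Dflux (h : RadialSolution μ β γ R T ρ u) {r t : ℝ} (hr : r ∈ Ioo 0 R)
    (ht : t ∈ Icc 0 T) :
    pd2 (flux μ β γ ρ u) r t + u r t * (ρ r t * mder u r t) =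
      (2 * μ + ρ r t ^ β) * (rdiv (mder u) r t - gradSq u r t)
        - β * ρ r t ^ β * (rdiv u r t) ^ 2 + γ * ρ r t ^ γ * rdiv u r t := by
  have hm := h.mass' hr ht
  have hr0 : r ≠ 0 := hr.1.ne'
  have hpos := h.ρ_pos r (Ioo_subset_Icc_self hr) t ht
  rw [← h.mom' hr ht, ← rdiv_mder h.su hr0 t]
  have e1 : pd1 (flux μ β γ ρ u) r t = _ := (flux_h1 h.sρ h.su hr0 hpos).deriv
  have e2 : pd2 (flux μ β γ ρ u) r t = _ := (flux_h2 h.sρ h.su hpos).deriv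
  have hb : ρ r t ^ β = ρ r t ^ (β - 1) * ρ r t := by
    rw [Real.rpow_sub_one hpos.ne']; field_simp
  have hg : ρ r t ^ γ = ρ r t ^ (γ - 1) * ρ r t := by
    rw [Real.rpow_sub_one hpos.ne']; field_simp
  rw [e1, e2, hb, hg]
  linear_combination (β * ρ r t ^ (β - 1) * rdiv u r t - γ * ρ r t ^ (γ - 1)) * hm

/-- Derivative of the boundary-term function in the interior. -/
lemma RadialSolution.hasDeriv (h : RadialSolution μ β γ R T ρ u) {r t : ℝ} (hr : r ∈ Ioo 0 R)
    (ht : t ∈ Ioo 0 T) :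
    HasDerivAt (fun s => mder u s t * s * pd2 (flux μ β γ ρ u) s t
        + 1 / 2 * (ρ s t * u s t * mder u s t ^ 2 * s)
        + mder u s t * u s t * flux μ β γ ρ u s t - μ / 2 * mder u s t ^ 2)
      (1 / 2 * ((pd2 ρ r t * mder u r t ^ 2 + ρ r t * (2 * mder u r t * pd2 (mder u) r t)) * r)
        + r * (rdiv (mder u) r t * ((2 * μ + ρ r t ^ β) * (rdiv (mder u) r t - gradSq u r t)
          - β * ρ r t ^ β * (rdiv u r t) ^ 2 + γ * ρ r t ^ γ * rdiv u r t)
          + (pd1 (mder u) r t * (u r t / r) + mder u r t / r * pd1 u r t) * flux μ β γ ρ u r t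
          - μ * (mder u r t / r) * pd1 (mder u) r t)) r := by
  have ht' := Ioo_subset_Icc_self ht
  have hr0 : r ≠ 0 := hr.1.ne'
  have hpos := h.ρ_pos r (Ioo_subset_Icc_self hr) t ht'
  have ha := h.su.mder.h1 r t
  have hcd := flux_cd (μ := μ) (β := β) (γ := γ) h.sρ h.su hr0 hpos
  have hF : HasDerivAt (fun s => flux μ β γ ρ u s t) (ρ r t * mder u r t) r := by
    rw [← h.mom' hr ht']
    exact hasDerivAt_pd1 (hcd.differentiableAt (by simp))
  have hFt : HasDerivAt (fun s => pd2 (flux μ β γ ρ u) s t)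
      (pd2 ρ r t * mder u r t + ρ r t * pd2 (mder u) r t) r := by
    have e : pd2 (pd1 (flux μ β γ ρ u)) r t
        = pd2 ρ r t * mder u r t + ρ r t * pd2 (mder u) r t := by
      have : HasDerivAt (fun τ => pd1 (flux μ β γ ρ u) r τ) _ t :=
        ((h.sρ.h2 r t).fun_mul (h.su.mder.h2 r t)).congr_of_eventuallyEq (by
          filter_upwards [isOpen_Ioo.mem_nhds ht] with τ hτ
          exact h.mom' hr (Ioo_subset_Icc_self hτ))
      exact this.deriv
    rw [← e]
    exact mixed hcd
  have hm := h.mass' hr ht'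
  have hD := h.Dflux hr ht'
  rw [← hD]
  have hid : HasDerivAt (fun s : ℝ => s) 1 r := hasDerivAt_id r
  have := ((((ha.fun_mul hid).fun_mul hFt).fun_add
    (((((h.sρ.h1 r t).fun_mul (h.su.h1 r t)).fun_mul (ha.fun_pow 2)).fun_mul hid).const_mul
      (1 / 2))).fun_add ((ha.fun_mul (h.su.h1 r t)).fun_mul hF)).fun_sub
    ((ha.fun_pow 2).const_mul (μ / 2))
  refine this.congr_deriv ?_
  have e1 : rdiv u r t = pd1 u r t + u r t / r := rfl
  have e2 : rdiv (mder u) r t = pd1 (mder u) r t + mder u r t / r := rfl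
  rw [e1] at hm
  rw [e2]
  generalize pd2 (flux μ β γ ρ u) r t = A1 at *
  generalize flux μ β γ ρ u r t = A2 at *
  generalize pd1 (mder u) r t = A3 at *
  generalize pd2 (mder u) r t = A4 at *
  generalize mder u r t = A5 at *
  generalize pd1 u r t = A6 at *
  generalize pd1 ρ r t = A7 at *
  generalize pd2 ρ r t = A8 at *
  have hA8 : A8 = -(u r t * A7 + ρ r t * (A6 + u r t / r)) := by linarith
  rw [hA8]
  generalize u r t = A9 at *
  generalize ρ r t = A10 at *
  push_cast
  field_simp
  ring

end sol

lemma int_cont (R : ℝ) {f : ℝ → ℝ} (hf : Continuous f) : IntegrableOn f (Ioo 0 R) :=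
  (hf.continuousOn.integrableOn_Icc (a := 0) (b := R)).mono_set Ioo_subset_Icc_self

lemma int_r {R : ℝ} (hR : 0 < R) : ∫ r in Ioo (0:ℝ) R, r = R ^ 2 / 2 := by
  rw [← integral_Ioc_eq_integral_Ioo, ← intervalIntegral.integral_of_le hR.le, integral_id]
  ring

section sol2
variable {μ β γ R T : ℝ} {ρ u : ℝ → ℝ → ℝ}

lemma RadialSolution.mder_zero (h : RadialSolution μ β γ R T ρ u) {t : ℝ} (ht : t ∈ Ioo 0 T) :
    (pd2 u 0 t = 0 ∧ mder u 0 t = 0) ∧ mder u R t = 0 := by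
  have key : ∀ x : ℝ, (∀ t ∈ Icc 0 T, u x t = 0) → pd2 u x t = 0 ∧ mder u x t = 0 := by
    intro x hx
    have e : pd2 u x t = 0 := by
      have : (fun τ => u x τ) =ᶠ[𝓝 t] fun _ => 0 := by
        filter_upwards [isOpen_Ioo.mem_nhds ht] with τ hτ
        exact hx τ (Ioo_subset_Icc_self hτ)
      unfold pd2
      rw [this.deriv_eq]; simp
    refine ⟨e, ?_⟩
    rw [mder_eq]
    simp only
    rw [e, hx t (Ioo_subset_Icc_self ht)]
    ring
  exact ⟨key 0 h.bc0, (key R h.bcR).2⟩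

/-- The integrated identity: the interior expression integrates to zero. -/
lemma RadialSolution.int_zero (h : RadialSolution μ β γ R T ρ u) {t : ℝ} (ht : t ∈ Ioo 0 T)
    {X : ℝ → ℝ} (hX : Continuous X)
    (hXe : ∀ r ∈ Ioo 0 R, X r =
      (1 / 2 * ((pd2 ρ r t * mder u r t ^ 2 + ρ r t * (2 * mder u r t * pd2 (mder u) r t)) * r)
        + r * (rdiv (mder u) r t * ((2 * μ + ρ r t ^ β) * (rdiv (mder u) r t - gradSq u r t)
          - β * ρ r t ^ β * (rdiv u r t) ^ 2 + γ * ρ r t ^ γ * rdiv u r t)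
          + (pd1 (mder u) r t * (u r t / r) + mder u r t / r * pd1 u r t) * flux μ β γ ρ u r t
          - μ * (mder u r t / r) * pd1 (mder u) r t))) :
    ∫ r in Ioo (0:ℝ) R, X r = 0 := by
  have ht' := Ioo_subset_Icc_self ht
  obtain ⟨⟨hut0, ha0⟩, haR⟩ := h.mder_zero ht
  have hu0 := h.bc0 t ht'
  have huR := h.bcR t ht'
  have cr : ∀ q : ℝ, 0 ≤ q → Continuous (fun r => ρ r t ^ q) := fun q hq =>
    (h.sρ.cont1 t).rpow_const fun _ => Or.inr hq
  have hβ := h.hβ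
  have hγ := h.hγ
  set Ft : ℝ → ℝ := fun r => pd2 ρ r t * β * ρ r t ^ (β - 1) * (pd1 u r t + qt u t r)
        + (2 * μ + ρ r t ^ β) * (pd2 (pd1 u) r t + qt (pd2 u) t r)
        - pd2 ρ r t * γ * ρ r t ^ (γ - 1) with hFt
  set Fe : ℝ → ℝ := fun r => (2 * μ + ρ r t ^ β) * (pd1 u r t + qt u t r) - ρ r t ^ γ with hFe
  have c1 := h.su.cont1 t
  have c2 := h.sρ.cont1 t
  have c3 := h.su.mder.cont1 t
  have c4 := h.su.pd1.cont1 t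
  have c5 := h.sρ.pd2.cont1 t
  have c6 := h.su.pd1.pd2.cont1 t
  have c7 := qt_cont h.su t
  have c8 := qt_cont h.su.pd2 t
  have c9 := cr β (by linarith)
  have c10 := cr γ (by linarith)
  have c11 := cr (β - 1) (by linarith)
  have c12 := cr (γ - 1) (by linarith)
  have cFt : Continuous Ft := by rw [hFt]; fun_prop
  have cFe : Continuous Fe := by rw [hFe]; fun_prop
  have eFt : ∀ r ∈ Ioo 0 R, Ft r = pd2 (flux μ β γ ρ u) r t := by
    intro r hr
    have hr0 : r ≠ 0 := hr.1.ne'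
    have hpos := h.ρ_pos r (Ioo_subset_Icc_self hr) t ht'
    have e2 : pd2 (flux μ β γ ρ u) r t = _ := (flux_h2 h.sρ h.su hpos).deriv
    rw [e2, (rdiv_h2 h.su r t).deriv, hFt]
    simp only
    rw [qt_eq hu0 hr0, qt_eq hut0 hr0]
    rfl
  have eFe : ∀ r ∈ Ioo 0 R, Fe r = flux μ β γ ρ u r t := by
    intro r hr
    rw [hFe]
    simp only
    rw [qt_eq hu0 hr.1.ne']
    rfl
  have key := intervalIntegral.integral_eq_sub_of_hasDerivAt_of_le (a := 0) (b := R)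
    (f := fun s => mder u s t * s * Ft s
        + 1 / 2 * (ρ s t * u s t * mder u s t ^ 2 * s)
        + mder u s t * u s t * Fe s - μ / 2 * mder u s t ^ 2) (f' := X) h.hR.le
    (Continuous.continuousOn (by fun_prop)) (by
      intro r hr
      rw [hXe r hr]
      refine (h.hasDeriv hr ht).congr_of_eventuallyEq ?_
      filter_upwards [isOpen_Ioo.mem_nhds hr] with s hs
      rw [eFt s hs, eFe s hs]) (hX.intervalIntegrable _ _)
  rw [← integral_Ioc_eq_integral_Ioo, ← intervalIntegral.integral_of_le h.hR.le, key]
  simp [ha0, haR]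

lemma RadialSolution.main (h : RadialSolution μ β γ R T ρ u) {C₀ : ℝ} (hC₀ : 0 < C₀)
    (hb : ∀ r ∈ Icc (0:ℝ) R, ∀ t ∈ Icc (0:ℝ) T, ρ r t ≤ C₀) {t : ℝ} (ht : t ∈ Ioo 0 T) :
    (1 / 2) * (∫ r in Ioo (0:ℝ) R,
        (pd2 ρ r t * mder u r t ^ 2 + ρ r t * (2 * mder u r t * pd2 (mder u) r t)) * r)
      + μ * (∫ r in Ioo (0:ℝ) R, (rdiv (mder u) r t) ^ 2 * r)
      + (1 / 2) * (∫ r in Ioo (0:ℝ) R,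
          ρ r t ^ β *
            (deriv (fun τ => rdiv u r τ) t + u r t * deriv (fun s => rdiv u s t) r) ^ 2 * r)
      ≤ cst μ β γ (C₀ ^ β) (C₀ ^ γ) * (∫ r in Ioo (0:ℝ) R, (gradSq u r t) ^ 2 * r)
        + cst μ β γ (C₀ ^ β) (C₀ ^ γ) * (R ^ 2 / 2) := by
  have ht' := Ioo_subset_Icc_self ht
  obtain ⟨⟨hut0, ha0⟩, haR⟩ := h.mder_zero ht
  have hu0 := h.bc0 t ht'
  have cr : ∀ q : ℝ, 0 ≤ q → Continuous (fun r => ρ r t ^ q) := fun q hq =>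
    (h.sρ.cont1 t).rpow_const fun _ => Or.inr hq
  have hμ := h.hμ
  have hβ := h.hβ
  have hγ := h.hγ
  have c1 := h.su.cont1 t
  have c2 := h.sρ.cont1 t
  have c3 := h.su.mder.cont1 t
  have c4 := h.su.pd1.cont1 t
  have c5 := h.sρ.pd2.cont1 t
  have c6 := h.su.mder.pd1.cont1 t
  have c6' := h.su.mder.pd2.cont1 t
  have c7 := qt_cont h.su t
  have c8 := qt_cont h.su.mder t
  have c9 := cr β (by linarith)
  have c10 := cr γ (by linarith)
  set C := cst μ β γ (C₀ ^ β) (C₀ ^ γ) with hC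
  set l1 : ℝ → ℝ := fun r =>
    (pd2 ρ r t * mder u r t ^ 2 + ρ r t * (2 * mder u r t * pd2 (mder u) r t)) * r with hl1
  set A : ℝ → ℝ := fun r => pd1 (mder u) r t + qt (mder u) t r with hA
  set d : ℝ → ℝ := fun r => pd1 u r t + qt u t r with hd
  set G : ℝ → ℝ := fun r => pd1 u r t ^ 2 + qt u t r ^ 2 with hG
  have cA : Continuous A := by rw [hA]; fun_prop
  have cd : Continuous d := by rw [hd]; fun_prop
  have cG : Continuous G := by rw [hG]; fun_prop
  have cl1 : Continuous l1 := by rw [hl1]; fun_prop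
  set X : ℝ → ℝ := fun r => 1 / 2 * l1 r + r * (A r * ((2 * μ + ρ r t ^ β) * (A r - G r)
    - β * ρ r t ^ β * (d r) ^ 2 + γ * ρ r t ^ γ * d r)
    + (pd1 (mder u) r t * qt u t r + qt (mder u) t r * pd1 u r t)
      * ((2 * μ + ρ r t ^ β) * d r - ρ r t ^ γ)
    - μ * qt (mder u) t r * pd1 (mder u) r t) with hX
  have cX : Continuous X := by rw [hX]; fun_prop
  have eA : ∀ r ∈ Ioo 0 R, rdiv (mder u) r t = A r := by
    intro r hr
    simp only [hA, qt_eq ha0 hr.1.ne']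
    rfl
  have ed : ∀ r ∈ Ioo 0 R, rdiv u r t = d r := by
    intro r hr
    simp only [hd, qt_eq hu0 hr.1.ne']
    rfl
  have eG : ∀ r ∈ Ioo 0 R, gradSq u r t = G r := by
    intro r hr
    simp only [hG, qt_eq hu0 hr.1.ne']
    rfl
  have iX : ∫ r in Ioo (0:ℝ) R, X r = 0 := by
    refine h.int_zero ht cX ?_
    intro r hr
    have eF : flux μ β γ ρ u r t = (2 * μ + ρ r t ^ β) * rdiv u r t - ρ r t ^ γ := rfl
    rw [eF, eA r hr, ed r hr, eG r hr, ← qt_eq ha0 hr.1.ne', ← qt_eq hu0 hr.1.ne']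
  have i2 : ∫ r in Ioo (0:ℝ) R, (rdiv (mder u) r t) ^ 2 * r
      = ∫ r in Ioo (0:ℝ) R, (A r) ^ 2 * r :=
    setIntegral_congr_fun measurableSet_Ioo fun r hr => by simp only [eA r hr]
  have i3 : ∫ r in Ioo (0:ℝ) R, ρ r t ^ β *
        (deriv (fun τ => rdiv u r τ) t + u r t * deriv (fun s => rdiv u s t) r) ^ 2 * r
      = ∫ r in Ioo (0:ℝ) R, ρ r t ^ β * (A r - G r) ^ 2 * r :=
    setIntegral_congr_fun measurableSet_Ioo fun r hr => by
      simp only [rdiv_mder h.su hr.1.ne', eA r hr, eG r hr]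
  have i4 : ∫ r in Ioo (0:ℝ) R, (gradSq u r t) ^ 2 * r
      = ∫ r in Ioo (0:ℝ) R, (G r) ^ 2 * r :=
    setIntegral_congr_fun measurableSet_Ioo fun r hr => by simp only [eG r hr]
  rw [i2, i3, i4, ← int_r h.hR, ← integral_const_mul, ← integral_const_mul, ← integral_const_mul,
    ← integral_const_mul, ← integral_const_mul,
    ← integral_add (int_cont R (by fun_prop)) (int_cont R (by fun_prop)),
    ← integral_add (int_cont R (by fun_prop)) (int_cont R (by fun_prop)),
    ← integral_add (int_cont R (by fun_prop)) (int_cont R (by fun_prop))]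
  have hsum : ∫ r in Ioo (0:ℝ) R, (C * (G r ^ 2 * r) + C * r)
      = ∫ r in Ioo (0:ℝ) R, (X r + (C * (G r ^ 2 * r) + C * r)) := by
    rw [integral_add (int_cont R cX) (int_cont R (by fun_prop)), iX, zero_add]
  rw [hsum]
  refine setIntegral_mono_on (int_cont R (by fun_prop)) (int_cont R (by fun_prop))
    measurableSet_Ioo ?_
  intro r hr
  have hpos := h.ρ_pos r (Ioo_subset_Icc_self hr) t ht'
  have hle := hb r (Ioo_subset_Icc_self hr) t ht'
  have key := pointwise_alg (μ := μ) (β := β) (γ := γ) (lam := C₀ ^ β) (pp := C₀ ^ γ)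
    (l := ρ r t ^ β) (p := ρ r t ^ γ) (x := pd1 (mder u) r t) (y := qt (mder u) t r)
    (a := pd1 u r t) (b := qt u t r) hμ (by linarith) (by linarith)
    (Real.rpow_nonneg hpos.le _) (Real.rpow_le_rpow hpos.le hle (by linarith))
    (Real.rpow_nonneg hpos.le _) (Real.rpow_le_rpow hpos.le hle (by linarith))
  have key2 := mul_le_mul_of_nonneg_left key hr.1.le
  simp only [hX, hA, hd, hG]
  linarith

end sol2

/-- **Energy estimate for the material derivative.** If `‖ρ‖_{L^∞} ≤ C₀`, then there is a
constant `C` depending only on `C₀, μ, β, γ` and `Ω` such that for `t ∈ (0,T)`,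
`(1/2)(d/dt)‖√ρ u̇‖₂² + μ‖div u̇‖₂² + (1/2)∫_Ω λ |D(div u)/Dt|² dx ≤ C‖∇u‖₄⁴ + C`. -/
theorem material_derivative_estimate
    (μ β γ R C₀ : ℝ)
    (hμ : 0 < μ) (hβ : 1 < β) (hγ : 1 < γ) (hR : 0 < R) (hC₀ : 0 < C₀) :
    ∃ C > 0, ∀ T > 0, ∀ ρ u : ℝ → ℝ → ℝ,
      RadialSolution μ β γ R T ρ u →
      (∀ r ∈ Icc (0:ℝ) R, ∀ t ∈ Icc (0:ℝ) T, ρ r t ≤ C₀) →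
      ∀ t ∈ Ioo (0:ℝ) T,
        (1 / 2) * deriv (fun τ => 2 * Real.pi *
              ∫ r in Ioo (0:ℝ) R, ρ r τ * (mder u r τ) ^ 2 * r) t
          + μ * (2 * Real.pi * ∫ r in Ioo (0:ℝ) R, (rdiv (mder u) r t) ^ 2 * r)
          + (1 / 2) * (2 * Real.pi * ∫ r in Ioo (0:ℝ) R,
              ρ r t ^ β *
                (deriv (fun τ => rdiv u r τ) t + u r t * deriv (fun s => rdiv u s t) r) ^ 2 * r)
          ≤ C * (2 * Real.pi * ∫ r in Ioo (0:ℝ) R, (gradSq u r t) ^ 2 * r) + C := by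
  have hc := cst_pos hμ (by linarith : 0 < β) (by linarith : 0 < γ)
    (Real.rpow_nonneg hC₀.le β) (Real.rpow_nonneg hC₀.le γ)
  set c := cst μ β γ (C₀ ^ β) (C₀ ^ γ) with hcdef
  have hpi := Real.pi_pos
  refine ⟨c * (1 + Real.pi * R ^ 2), by positivity, ?_⟩
  intro T hT ρ u h hb t ht
  have hmain := h.main hC₀ hb ht
  rw [← hcdef] at hmain
  have hsm : Smo (fun r τ => ρ r τ * (mder u r τ) ^ 2 * r) := by
    have h1 := h.sρ
    have h2 := h.su.mder
    unfold Smo at *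
    exact (h1.mul (h2.pow 2)).mul contDiff_fst
  have hder := (deriv_int_s14 hsm R t).const_mul (2 * Real.pi)
  have e : ∀ r, pd2 (fun r τ => ρ r τ * (mder u r τ) ^ 2 * r) r t
      = (pd2 ρ r t * mder u r t ^ 2 + ρ r t * (2 * mder u r t * pd2 (mder u) r t)) * r := by
    intro r
    have := (((h.sρ.h2 r t).fun_mul ((h.su.mder.h2 r t).fun_pow 2)).mul_const r).deriv
    refine Eq.trans this ?_
    push_cast
    ring
  simp only [e] at hder
  rw [hder.deriv]
  have hG : 0 ≤ ∫ r in Ioo (0:ℝ) R, (gradSq u r t) ^ 2 * r :=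
    setIntegral_nonneg measurableSet_Ioo fun r hr => mul_nonneg (sq_nonneg _) hr.1.le
  have h1 := mul_le_mul_of_nonneg_left hmain (by positivity : (0:ℝ) ≤ 2 * Real.pi)
  have h2 : 0 ≤ c * (Real.pi * R ^ 2) *
      (2 * Real.pi * ∫ r in Ioo (0:ℝ) R, (gradSq u r t) ^ 2 * r) := by positivity
  linarith
end
end
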